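/- arXiv:1507.07727 — 4 statements merged into one kernel-verified Lean document; each statement's English description precedes it below -/
import Mathlib

section
/- Let G = (V, E) be a digraph. If κ(G) = P·Q for polynomials P and Q, then var(P) ∩ var(Q) = ∅, i.e. no variable x_e appears (in a monomial with nonzero coefficient) in both P and Q. -/
open MvPolynomial

/-- A finite directed (multi)graph with abstractly named edges: a finite set of
vertices, a finite set of edge names, and source/target maps.  Edge names double
as the labels/variables of the Kirchhoff polynomial. -/
structure MultiDigraph (V : Type*) (ε : Type*) where
  verts : Finset V
  edges : Finset ε
  src : ε → V
  tgt : ε → V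

namespace MultiDigraph

variable {V : Type*} {ε : Type*} [DecidableEq V] [DecidableEq ε]

/-- One step along an edge of `A`. -/
def Step (G : MultiDigraph V ε) (A : Finset ε) (x y : V) : Prop :=
  ∃ e ∈ A, G.src e = x ∧ G.tgt e = y

/-- Directed reachability using only edges of `A`. -/
def Reaches (G : MultiDigraph V ε) (A : Finset ε) (x y : V) : Prop :=
  Relation.ReflTransGen (G.Step A) x y

/-- Every edge has both of its endpoints among the vertices. -/
def WellFormed (G : MultiDigraph V ε) : Prop :=
  ∀ e ∈ G.edges, G.src e ∈ G.verts ∧ G.tgt e ∈ G.verts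

/-- `G` is a simple digraph: it has no loops and no parallel edges. -/
def Simple (G : MultiDigraph V ε) : Prop :=
  (∀ e ∈ G.edges, G.src e ≠ G.tgt e) ∧
    ∀ e ∈ G.edges, ∀ e' ∈ G.edges, G.src e = G.src e' → G.tgt e = G.tgt e' → e = e'

/-- `A` is (the edge set of) an arborescence of `G` rooted at `r`: a spanning
subdigraph in which every vertex other than the root has exactly one incoming
edge, the root has none, and every vertex is reachable from the root (hence
along a unique directed path). -/
def IsArbAt (G : MultiDigraph V ε) (A : Finset ε) (r : V) : Prop :=
  A ⊆ G.edges ∧ r ∈ G.verts ∧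
  (∀ e ∈ A, G.src e ∈ G.verts ∧ G.tgt e ∈ G.verts) ∧
  (∀ e ∈ A, G.tgt e ≠ r) ∧
  (∀ w ∈ G.verts, w ≠ r → ∃! e, e ∈ A ∧ G.tgt e = w) ∧
  (∀ w ∈ G.verts, G.Reaches A r w)

/-- `A` is an arborescence of `G` (rooted at some vertex). -/
def IsArb (G : MultiDigraph V ε) (A : Finset ε) : Prop :=
  ∃ r, G.IsArbAt A r

open Classical in
/-- The Kirchhoff polynomial of `G`: the sum, over all arborescences, of the
products of the variables of their edges. -/
noncomputable def kirchhoff (G : MultiDigraph V ε) : MvPolynomial ε ℚ :=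
  ∑ A ∈ G.edges.powerset.filter (fun A => G.IsArb A), ∏ e ∈ A, X e

open Classical in
/-- The Kirchhoff polynomial of arborescences of `G` rooted at `r`. -/
noncomputable def kirchhoffAt (G : MultiDigraph V ε) (r : V) : MvPolynomial ε ℚ :=
  ∑ A ∈ G.edges.powerset.filter (fun A => G.IsArbAt A r), ∏ e ∈ A, X e

/-- The incoming edges of vertex `v`. -/
def inEdges (G : MultiDigraph V ε) (v : V) : Finset ε :=
  G.edges.filter (fun e => G.tgt e = v)

/-- `G` is rooted at `v`: `v` has no incoming edges and every vertex is
reachable from `v`. -/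
def RootedAt (G : MultiDigraph V ε) (v : V) : Prop :=
  v ∈ G.verts ∧ (∀ e ∈ G.edges, G.tgt e ≠ v) ∧ ∀ w ∈ G.verts, G.Reaches G.edges v w

/-- `G` is strongly connected. -/
def StronglyConnected (G : MultiDigraph V ε) : Prop :=
  ∀ x ∈ G.verts, ∀ y ∈ G.verts, G.Reaches G.edges x y

/-- `G` is (weakly) connected. -/
def WeaklyConnected (G : MultiDigraph V ε) : Prop :=
  ∀ x ∈ G.verts, ∀ y ∈ G.verts,
    Relation.ReflTransGen (fun a b => G.Step G.edges a b ∨ G.Step G.edges b a) x y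

/-- The induced subdigraph `G[D]`. -/
def induce (G : MultiDigraph V ε) (D : Finset V) : MultiDigraph V ε where
  verts := D
  edges := G.edges.filter (fun e => G.src e ∈ D ∧ G.tgt e ∈ D)
  src := G.src
  tgt := G.tgt

/-- `root_u(G)`: remove all edges incoming to `u`. -/
def rootAt (G : MultiDigraph V ε) (u : V) : MultiDigraph V ε where
  verts := G.verts
  edges := G.edges.filter (fun e => G.tgt e ≠ u)
  src := G.src
  tgt := G.tgt

/-- Delete a single edge. -/
def deleteEdge (G : MultiDigraph V ε) (e₀ : ε) : MultiDigraph V ε where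
  verts := G.verts
  edges := G.edges.erase e₀
  src := G.src
  tgt := G.tgt

/-- The contraction `G(S → u)`: all edges from `Vᶜ∖S` into `S∖{u}` and all edges
inside `S` are removed, and `S` is contracted into the single vertex `u`;
edges retain their names (labels). -/
def contract (G : MultiDigraph V ε) (S : Finset V) (u : V) : MultiDigraph V ε where
  verts := insert u (G.verts \ S)
  edges := G.edges.filter (fun e => G.tgt e ∉ S ∨ (G.src e ∉ S ∧ G.tgt e = u))
  src := fun e => if G.src e ∈ S then u else G.src e
  tgt := fun e => if G.tgt e ∈ S then u else G.tgt e

/-- Directed walks from `x` to `y`, given as lists of edges taken from `A`. -/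
def IsWalk (G : MultiDigraph V ε) (A : Finset ε) : List ε → V → V → Prop
  | [], x, y => x = y
  | e :: p, x, y => e ∈ A ∧ G.src e = x ∧ IsWalk G A p (G.tgt e) y

/-- A simple directed path from `x` to `y` (no repeated vertices). -/
def IsPath (G : MultiDigraph V ε) (A : Finset ε) (p : List ε) (x y : V) : Prop :=
  G.IsWalk A p x y ∧ (x :: p.map G.tgt).Nodup

/-- A simple directed cycle through `x` (no repeated vertices). -/
def IsCycle (G : MultiDigraph V ε) (A : Finset ε) (p : List ε) (x : V) : Prop :=
  p ≠ [] ∧ G.IsWalk A p x x ∧ (p.map G.tgt).Nodup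

/-- The edge set `A` contains no directed cycle. -/
def Acyclic (G : MultiDigraph V ε) (A : Finset ε) : Prop :=
  ¬ ∃ p x, G.IsCycle A p x

/-- In `G` rooted at `v`, vertex `u` dominates vertex `w`: every directed path
from `v` to `w` passes through `u`. -/
def Dominates (G : MultiDigraph V ε) (v u w : V) : Prop :=
  ∀ p : List ε, G.IsPath G.edges p v w → u ∈ v :: p.map G.tgt

open Classical in
/-- `dom_G(u)` (w.r.t. the root `v`): the set of all vertices dominated by `u`. -/
noncomputable def domSet (G : MultiDigraph V ε) (v u : V) : Finset V :=
  G.verts.filter (fun w => G.Dominates v u w)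

/-- In `G` rooted at `v`, `y` is an immediate dominator of `z`. -/
def ImmDominates (G : MultiDigraph V ε) (v y z : V) : Prop :=
  y ≠ z ∧ G.Dominates v y z ∧
    ∀ x ∈ G.verts, x ≠ y → x ≠ z → G.Dominates v x z → G.Dominates v x y

open Classical in
/-- `imm_G(y)` (w.r.t. the root `v`): the set of vertices immediately dominated by `y`. -/
noncomputable def immSet (G : MultiDigraph V ε) (v y : V) : Finset V :=
  G.verts.filter (fun z => G.ImmDominates v y z)

open Classical in
/-- The simultaneous contraction `G(dom(z₁) → z₁; …; dom(z_i) → z_i)` for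
`Z = {z₁, …, z_i}` (domination w.r.t. the root `v`). -/
noncomputable def domContract (G : MultiDigraph V ε) (v : V) (Z : Finset V) :
    MultiDigraph V ε where
  verts := G.verts.filter (fun x => ∀ z ∈ Z, G.Dominates v z x → x = z)
  edges := G.edges.filter (fun e =>
    (∀ z ∈ Z, ¬(G.Dominates v z (G.src e) ∧ G.Dominates v z (G.tgt e))) ∧
    (∀ z ∈ Z, ¬(¬ G.Dominates v z (G.src e) ∧ G.Dominates v z (G.tgt e) ∧ G.tgt e ≠ z)))
  src := fun e =>
    if h : ∃ z ∈ Z, G.Dominates v z (G.src e) ∧ G.src e ≠ z then h.choose else G.src e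
  tgt := fun e =>
    if h : ∃ z ∈ Z, G.Dominates v z (G.tgt e) ∧ G.tgt e ≠ z then h.choose else G.tgt e

/-- Mutual directed reachability in `G`. -/
def MutuallyReachable (G : MultiDigraph V ε) (x y : V) : Prop :=
  G.Reaches G.edges x y ∧ G.Reaches G.edges y x

open Classical in
/-- `W` is (the vertex set of) a strongly connected component of `G`, i.e. an
equivalence class of mutual reachability. -/
def IsSCC (G : MultiDigraph V ε) (W : Finset V) : Prop :=
  ∃ x ∈ G.verts, W = G.verts.filter (fun y => G.MutuallyReachable x y)

/-- `W` is a minimal element in the partial order that reachability induces on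
the strongly connected components of `G` (an initial SCC). -/
def IsMinimalSCC (G : MultiDigraph V ε) (W : Finset V) : Prop :=
  G.IsSCC W ∧ ∀ W', G.IsSCC W' → (∃ x ∈ W', ∃ y ∈ W, G.Reaches G.edges x y) → W' = W

open Classical in
/-- The digraph `Ĝ(W)` associated with a strongly connected component `G[W]`:
if `G[W]` has no incoming edges (it is the initial SCC) it is `G[W]` itself;
otherwise a new auxiliary vertex (here `none`) is added and every edge of `G`
entering `W` from outside is redirected to start at the auxiliary vertex,
keeping its label. -/
noncomputable def hatSCC (G : MultiDigraph V ε) (W : Finset V) :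
    MultiDigraph (Option V) ε where
  verts :=
    if ∃ e ∈ G.edges, G.tgt e ∈ W ∧ G.src e ∉ W then insert none (W.image some)
    else W.image some
  edges := G.edges.filter (fun e => G.tgt e ∈ W)
  src := fun e => if G.src e ∈ W then some (G.src e) else none
  tgt := fun e => some (G.tgt e)

/-- `u` is an independent vertex of the simple directed cycle `C` (w.r.t. the
root `v`): `u` lies on `C` and there is a simple directed path from `v` to `u`
which is vertex-disjoint from `C` except at `u`. -/
def IsIndependentVertex (G : MultiDigraph V ε) (v : V) (C : List ε) (u : V) : Prop :=
  u ∈ C.map G.tgt ∧ ∃ p, G.IsPath G.edges p v u ∧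
    ∀ z ∈ v :: p.map G.tgt, z ∈ C.map G.tgt → z = u

end MultiDigraph

open MvPolynomial

variable {V : Type*} {ε : Type*} [DecidableEq V] [DecidableEq ε]

/-- A sum of squarefree monomials has degree at most one in each variable. -/
theorem MvPolynomial.degreeOf_sum_prod_X_le_one {σ R : Type*} [CommSemiring R] [Nontrivial R]
    (S : Finset (Finset σ)) (i : σ) :
    (∑ A ∈ S, ∏ e ∈ A, (X e : MvPolynomial σ R)).degreeOf i ≤ 1 := by
  classical
  refine (degreeOf_sum_le i S _).trans (Finset.sup_le fun A _ => ?_)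
  refine (degreeOf_prod_le i A _).trans ?_
  simp only [degreeOf_X, Finset.sum_ite_eq]
  split_ifs <;> simp

/-- If `κ(G) = P·Q` then no variable appears in both `P` and `Q`. -/
theorem statement_1 (G : MultiDigraph V ε) (hwf : G.WellFormed) (hsimple : G.Simple)
    (P Q : MvPolynomial ε ℚ) (hfac : G.kirchhoff = P * Q) :
    P.vars ∩ Q.vars = ∅ := by
  by_cases hP : P = 0
  · simp [hP]
  by_cases hQ : Q = 0
  · simp [hQ]
  refine Finset.eq_empty_of_forall_notMem fun e he => ?_
  obtain ⟨heP, heQ⟩ := Finset.mem_inter.mp he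
  have hle : G.kirchhoff.degreeOf e ≤ 1 := degreeOf_sum_prod_X_le_one _ e
  rw [hfac, degreeOf_mul_eq hP hQ] at hle
  have h₁ : P.degreeOf e ≠ 0 := mem_vars_iff_degreeOf_ne_zero.mp heP
  have h₂ : Q.degreeOf e ≠ 0 := mem_vars_iff_degreeOf_ne_zero.mp heQ
  omega
end

section
/- Let G = (V, E) be a strongly connected digraph with at least two vertices. Then the Kirchhoff polynomial κ(G) is prime (irreducible): it admits no factorization κ(G) = P·Q with both P and Q non-constant polynomials. -/
open MvPolynomial

open MvPolynomial

namespace MvPolynomial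

variable {σ R : Type*} [CommRing R]

/-- Over a domain, some monomial of a product attains the sum of the weighted degrees of two
given monomials of the factors, or exceeds it. -/
theorem exists_mem_support_mul_weight_ge [IsDomain R] (w : σ → ℕ) {p q : MvPolynomial σ R}
    {a b : σ →₀ ℕ} (ha : a ∈ p.support) (hb : b ∈ q.support) :
    ∃ d ∈ (p * q).support, Finsupp.weight w a + Finsupp.weight w b ≤ Finsupp.weight w d := by
  classical
  obtain ⟨x, hx, hxmax⟩ := p.support.exists_max_image (Finsupp.weight w) ⟨a, ha⟩
  obtain ⟨y, hy, hymax⟩ := q.support.exists_max_image (Finsupp.weight w) ⟨b, hb⟩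
  set m := Finsupp.weight w x
  set n := Finsupp.weight w y
  have hp : weightedHomogeneousComponent w m p ≠ 0 := fun h => by
    have := congrArg (coeff x) h
    rw [coeff_weightedHomogeneousComponent, if_pos rfl] at this
    exact mem_support_iff.1 hx this
  have hq : weightedHomogeneousComponent w n q ≠ 0 := fun h => by
    have := congrArg (coeff y) h
    rw [coeff_weightedHomogeneousComponent, if_pos rfl] at this
    exact mem_support_iff.1 hy this
  obtain ⟨d, hd⟩ := ne_zero_iff.1 (mul_ne_zero hp hq)
  have hdw : Finsupp.weight w d = m + n :=
    ((weightedHomogeneousComponent_isWeightedHomogeneous m p).mul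
      (weightedHomogeneousComponent_isWeightedHomogeneous n q)) hd
  refine ⟨d, ?_, by rw [hdw]; exact add_le_add (hxmax a ha) (hymax b hb)⟩
  rw [mem_support_iff]
  convert! hd using 1
  rw [coeff_mul, coeff_mul]
  refine Finset.sum_congr rfl fun u hu => ?_
  have hsum : Finsupp.weight w u.1 + Finsupp.weight w u.2 = m + n := by
    rw [← map_add, Finset.HasAntidiagonal.mem_antidiagonal.1 hu, hdw]
  rw [coeff_weightedHomogeneousComponent, coeff_weightedHomogeneousComponent]
  by_cases h1 : coeff u.1 p = 0
  · simp [h1]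
  by_cases h2 : coeff u.2 q = 0
  · simp [h2]
  have := hxmax u.1 (mem_support_iff.2 h1)
  have := hymax u.2 (mem_support_iff.2 h2)
  rw [if_pos (by omega), if_pos (by omega)]

/-- If `p` and `q` have no variable in common, the product of a monomial of `p` and a monomial
of `q` is a monomial of `p * q`. -/
theorem add_mem_support_mul [IsDomain R] {p q : MvPolynomial σ R}
    (hpq : Disjoint p.vars q.vars) {a b : σ →₀ ℕ} (ha : a ∈ p.support) (hb : b ∈ q.support) :
    a + b ∈ (p * q).support := by
  classical
  have hvars : ∀ {f : MvPolynomial σ R} {d : σ →₀ ℕ}, d ∈ f.support →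
      ∀ i, i ∉ f.vars → d i = 0 := fun hd i hi => by
    by_contra h
    exact hi ((mem_vars_iff_mem_support _).2 ⟨_, hd, Finsupp.mem_support_iff.2 h⟩)
  rw [mem_support_iff, coeff_mul, Finset.sum_eq_single (a, b)]
  · exact mul_ne_zero (mem_support_iff.1 ha) (mem_support_iff.1 hb)
  · rintro ⟨x, y⟩ hxy hne
    by_contra h
    have hx : x ∈ p.support := mem_support_iff.2 (left_ne_zero_of_mul h)
    have hy : y ∈ q.support := mem_support_iff.2 (right_ne_zero_of_mul h)
    have hs : x + y = a + b := Finset.HasAntidiagonal.mem_antidiagonal.1 hxy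
    have hxa : x = a := by
      ext i
      by_cases hi : i ∈ p.vars
      · have hi' := Finset.disjoint_left.1 hpq hi
        have := DFunLike.congr_fun hs i
        simpa [hvars hy i hi', hvars hb i hi'] using this
      · rw [hvars hx i hi, hvars ha i hi]
    subst hxa
    exact hne (by rw [add_left_cancel hs])
  · simp

end MvPolynomial

namespace MultiDigraph

variable {V : Type*} {ε : Type*} {G : MultiDigraph V ε}

theorem Reaches.mono {A B : Finset ε} (hAB : A ⊆ B) {x y : V} (h : G.Reaches A x y) :
    G.Reaches B x y :=
  Relation.ReflTransGen.mono (fun _ _ ⟨e, he, hs⟩ => ⟨e, hAB he, hs⟩) _ _ h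

/-- A path leaving a set uses an edge leaving that set. -/
theorem Reaches.exists_edge_leaving {A : Finset ε} {S : Finset V} {x y : V}
    (h : G.Reaches A x y) (hx : x ∈ S) (hy : y ∉ S) :
    ∃ e ∈ A, G.src e ∈ S ∧ G.tgt e ∉ S := by
  induction h with
  | refl => exact absurd hx hy
  | tail _ hstep ih =>
    obtain ⟨e, he, rfl, rfl⟩ := hstep
    by_cases hb : G.src e ∈ S
    · exact ⟨e, he, hb, hy⟩
    · exact ih hb

/-- A strongly connected digraph has an arborescence rooted at any given vertex. -/
theorem StronglyConnected.exists_isArbAt (hwf : G.WellFormed) (hsc : G.StronglyConnected)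
    {r : V} (hr : r ∈ G.verts) : ∃ A, G.IsArbAt A r := by
  classical
  let T : Finset V → Prop := fun S => r ∈ S ∧ ∃ A ⊆ G.edges,
    (∀ e ∈ A, G.tgt e ∈ S) ∧ (∀ e ∈ A, G.tgt e ≠ r) ∧
    (∀ w ∈ S, w ≠ r → ∃! e, e ∈ A ∧ G.tgt e = w) ∧ ∀ w ∈ S, G.Reaches A r w
  have hne : (G.verts.powerset.filter T).Nonempty := by
    refine ⟨{r}, Finset.mem_filter.2 ⟨by simpa using hr, by simp, ∅, by simp, by simp, by simp,
      by simp, ?_⟩⟩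
    intro w hw
    rw [Finset.mem_singleton.1 hw]
    exact Relation.ReflTransGen.refl
  obtain ⟨S, hS, hmax⟩ := Finset.exists_max_image _ Finset.card hne
  obtain ⟨hSV, hrS, A, hAE, hAS, hAr, hAu, hAreach⟩ := Finset.mem_filter.1 hS
  rw [Finset.mem_powerset] at hSV
  suffices hall : ∀ w ∈ G.verts, w ∈ S from
    ⟨A, hAE, hr, fun e he => hwf e (hAE he), hAr, fun w hw => hAu w (hall w hw),
      fun w hw => hAreach w (hall w hw)⟩
  intro w hw
  by_contra hwS
  obtain ⟨e, he, hsrc, htgt⟩ := (hsc r hr w hw).exists_edge_leaving hrS hwS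
  have hle := hmax (insert (G.tgt e) S) (Finset.mem_filter.2 ⟨?_, by simp [hrS], insert e A,
    Finset.insert_subset he hAE, ?_, ?_, ?_, ?_⟩)
  · rw [Finset.card_insert_of_notMem htgt] at hle
    omega
  · exact Finset.mem_powerset.2 (Finset.insert_subset (hwf e he).2 hSV)
  · intro f hf
    rcases Finset.mem_insert.1 hf with rfl | hf
    · exact Finset.mem_insert_self _ _
    · exact Finset.mem_insert_of_mem (hAS f hf)
  · intro f hf
    rcases Finset.mem_insert.1 hf with rfl | hf
    · rintro h
      exact htgt (h ▸ hrS)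
    · exact hAr f hf
  · intro u hu hur
    rcases Finset.mem_insert.1 hu with rfl | huS
    · refine ⟨e, ⟨Finset.mem_insert_self _ _, rfl⟩, ?_⟩
      rintro f ⟨hf, hfe⟩
      rcases Finset.mem_insert.1 hf with rfl | hf
      · rfl
      · exact absurd (hfe ▸ hAS f hf) htgt
    · obtain ⟨f, ⟨hf, hfu⟩, huniq⟩ := hAu u huS hur
      refine ⟨f, ⟨Finset.mem_insert_of_mem hf, hfu⟩, ?_⟩
      rintro g ⟨hg, hgu⟩
      rcases Finset.mem_insert.1 hg with rfl | hg
      · exact absurd (hgu ▸ huS) htgt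
      · exact huniq g ⟨hg, hgu⟩
  · intro u hu
    rcases Finset.mem_insert.1 hu with rfl | hu
    · exact ((hAreach _ hsrc).mono (Finset.subset_insert _ _)).tail
        ⟨e, Finset.mem_insert_self _ _, rfl, rfl⟩
    · exact (hAreach u hu).mono (Finset.subset_insert _ _)

/-- The exponent vector of the square-free monomial with variables in `A`. -/
noncomputable def edgeExponent (A : Finset ε) : ε →₀ ℕ := ∑ e ∈ A, Finsupp.single e 1

theorem edgeExponent_apply [DecidableEq ε] (A : Finset ε) (e : ε) :
    edgeExponent A e = if e ∈ A then 1 else 0 := by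
  simp [edgeExponent, Finsupp.finsetSum_apply, Finsupp.single_apply]

theorem edgeExponent_injective : Function.Injective (edgeExponent (ε := ε)) := by
  classical
  intro A B h
  ext e
  have := DFunLike.congr_fun h e
  rw [edgeExponent_apply, edgeExponent_apply] at this
  by_cases hA : e ∈ A <;> by_cases hB : e ∈ B <;> simp_all

theorem weight_edgeExponent (A : Finset ε) (p : ε → Prop) [DecidablePred p] :
    Finsupp.weight (fun e => if p e then 1 else 0) (edgeExponent A) = (A.filter p).card := by
  simp [edgeExponent, Finsupp.weight_single]

theorem mem_support_kirchhoff {d : ε →₀ ℕ} :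
    d ∈ G.kirchhoff.support ↔ ∃ A, G.IsArb A ∧ d = edgeExponent A := by
  classical
  have hκ : G.kirchhoff = ∑ A ∈ G.edges.powerset.filter (fun A => G.IsArb A),
      monomial (edgeExponent A) (1 : ℚ) := by
    unfold kirchhoff
    refine Finset.sum_congr (by congr) fun A _ => ?_
    simp only [edgeExponent, monomial_sum_one, X]
  rw [mem_support_iff, hκ, coeff_sum]
  simp only [coeff_monomial]
  constructor
  · intro h
    obtain ⟨A, hA, hne⟩ := Finset.exists_ne_zero_of_sum_ne_zero h
    exact ⟨A, (Finset.mem_filter.1 hA).2, by_contra fun h => hne (if_neg (Ne.symm h))⟩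
  · rintro ⟨A, hA, rfl⟩
    have hmem : A ∈ G.edges.powerset.filter (fun A => G.IsArb A) := by
      obtain ⟨r, hr⟩ := hA
      exact Finset.mem_filter.2 ⟨Finset.mem_powerset.2 hr.1, r, hr⟩
    simp only [edgeExponent_injective.eq_iff, Finset.sum_ite_eq', hmem, if_true]
    exact one_ne_zero

theorem IsArb.card_filter_tgt_le_one [DecidableEq V] {A : Finset ε} (hA : G.IsArb A) (v : V) :
    (A.filter (fun e => G.tgt e = v)).card ≤ 1 := by
  obtain ⟨r, -, -, hV, hr, hu, -⟩ := hA
  refine Finset.card_le_one.2 fun e he f hf => ?_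
  obtain ⟨heA, rfl⟩ := Finset.mem_filter.1 he
  exact (hu _ (hV e heA).2 (hr e heA)).unique ⟨heA, rfl⟩ (Finset.mem_filter.1 hf)

/-- A variable of a factor of the Kirchhoff polynomial is an edge of `G`. -/
theorem mem_edges_of_mem_vars {P Q : MvPolynomial ε ℚ} (hfac : G.kirchhoff = P * Q)
    (hQ : Q ≠ 0) {e : ε} (he : e ∈ P.vars) : e ∈ G.edges := by
  classical
  obtain ⟨a, ha, hea⟩ := (mem_vars_iff_mem_support _).1 he
  obtain ⟨b, hb⟩ := support_nonempty.2 hQ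
  obtain ⟨d, hd, hle⟩ :=
    exists_mem_support_mul_weight_ge (fun f => if f = e then 1 else 0) ha hb
  obtain ⟨A, hA, rfl⟩ := mem_support_kirchhoff.1 (hfac ▸ hd)
  rw [weight_edgeExponent] at hle
  have hle' := Finsupp.le_weight (fun f => if f = e then 1 else 0) (s := e) (by simp) a
  have hpos := Nat.pos_of_ne_zero (Finsupp.mem_support_iff.1 hea)
  obtain ⟨f, hf⟩ := Finset.card_pos.1 (show 0 < (A.filter (· = e)).card by omega)
  obtain ⟨hfA, rfl⟩ := Finset.mem_filter.1 hf
  obtain ⟨r, hr⟩ := hA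
  exact hr.1 hfA

/-- Variables of complementary factors of the Kirchhoff polynomial have different targets. -/
theorem tgt_ne_of_mem_vars {P Q : MvPolynomial ε ℚ} (hfac : G.kirchhoff = P * Q)
    {e f : ε} (he : e ∈ P.vars) (hf : f ∈ Q.vars) : G.tgt e ≠ G.tgt f := by
  classical
  intro hef
  obtain ⟨a, ha, hea⟩ := (mem_vars_iff_mem_support _).1 he
  obtain ⟨b, hb, hfb⟩ := (mem_vars_iff_mem_support _).1 hf
  obtain ⟨d, hd, hle⟩ :=
    exists_mem_support_mul_weight_ge (fun g => if G.tgt g = G.tgt f then 1 else 0) ha hb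
  obtain ⟨A, hA, rfl⟩ := mem_support_kirchhoff.1 (hfac ▸ hd)
  rw [weight_edgeExponent] at hle
  have hA1 := hA.card_filter_tgt_le_one (G.tgt f)
  have hwa := Finsupp.le_weight (fun g => if G.tgt g = G.tgt f then 1 else 0) (s := e)
    (by simp [hef]) a
  have hwb := Finsupp.le_weight (fun g => if G.tgt g = G.tgt f then 1 else 0) (s := f)
    (by simp) b
  have := Nat.pos_of_ne_zero (Finsupp.mem_support_iff.1 hea)
  have := Nat.pos_of_ne_zero (Finsupp.mem_support_iff.1 hfb)
  omega

end MultiDigraph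

variable {V : Type*} {ε : Type*} [DecidableEq V] [DecidableEq ε]

/-- The Kirchhoff polynomial of a strongly connected digraph with at
least two vertices is prime: it has no factorization into two non-constant polynomials. -/
theorem statement_3 (G : MultiDigraph V ε) (hwf : G.WellFormed) (hsimple : G.Simple)
    (hsc : G.StronglyConnected) (hcard : 2 ≤ G.verts.card)
    (P Q : MvPolynomial ε ℚ) (hfac : G.kirchhoff = P * Q) :
    (∃ c : ℚ, P = MvPolynomial.C c) ∨ (∃ c : ℚ, Q = MvPolynomial.C c) := by
  classical
  have hconst : ∀ p : MvPolynomial ε ℚ, p.vars = ∅ → ∃ c : ℚ, p = MvPolynomial.C c :=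
    fun p hp => ⟨_, vars_eq_empty_iff_eq_C.1 hp⟩
  by_contra! hcon
  obtain ⟨hP, hQ⟩ := hcon
  have hP0 : P ≠ 0 := by simpa using hP 0
  have hQ0 : Q ≠ 0 := by simpa using hQ 0
  obtain ⟨e, he⟩ := Finset.nonempty_iff_ne_empty.2
    fun h => (hconst P h).elim hP
  obtain ⟨f, hf⟩ := Finset.nonempty_iff_ne_empty.2
    fun h => (hconst Q h).elim hQ
  have hdisj : Disjoint P.vars Q.vars := Finset.disjoint_left.2
    fun g hg hg' => MultiDigraph.tgt_ne_of_mem_vars hfac hg hg' rfl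
  have hfac' : G.kirchhoff = Q * P := by rw [hfac, mul_comm]
  obtain ⟨A, hA⟩ := hsc.exists_isArbAt hwf
    (hwf e (MultiDigraph.mem_edges_of_mem_vars hfac hQ0 he)).2
  obtain ⟨B, hB⟩ := hsc.exists_isArbAt hwf
    (hwf f (MultiDigraph.mem_edges_of_mem_vars hfac' hP0 hf)).2
  have hsplit : ∀ {D : Finset ε}, G.IsArb D →
      ∃ a ∈ P.support, ∃ b ∈ Q.support, a + b = MultiDigraph.edgeExponent D := by
    intro D hD
    have hmem := MultiDigraph.mem_support_kirchhoff.2 ⟨D, hD, rfl⟩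
    rw [hfac] at hmem
    exact Finset.mem_add.1 (support_mul _ _ hmem)
  obtain ⟨a, ha, a', ha', haA⟩ := hsplit ⟨_, hA⟩
  obtain ⟨b, hb, b', hb', hbB⟩ := hsplit ⟨_, hB⟩
  obtain ⟨D, ⟨t, hD⟩, hdD⟩ := MultiDigraph.mem_support_kirchhoff.1
    (hfac ▸ add_mem_support_mul hdisj hb ha')
  obtain ⟨-, ht, -, hDt, -, -⟩ := hD
  have hnotMem : ∀ g, G.tgt g = t → (b + a') g = 0 := fun g hg => by
    rw [hdD, MultiDigraph.edgeExponent_apply, if_neg fun h => hDt g h hg]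
  have hone : ∀ {D : Finset ε} {c c' : ε →₀ ℕ}, c + c' = MultiDigraph.edgeExponent D →
      ∀ g ∈ D, c g + c' g = 1 := fun h g hg => by
    rw [← Finsupp.add_apply, h, MultiDigraph.edgeExponent_apply, if_pos hg]
  by_cases htQ : ∃ g ∈ Q.vars, G.tgt g = t
  · obtain ⟨g, hg, hgt⟩ := htQ
    obtain ⟨k, ⟨hk, hkt⟩, -⟩ := hA.2.2.2.2.1 t ht
      fun h => MultiDigraph.tgt_ne_of_mem_vars hfac he hg (h.symm.trans hgt.symm)
    have hak : a k = 0 := mem_support_notMem_vars_zero ha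
      fun h => MultiDigraph.tgt_ne_of_mem_vars hfac h hg (hkt.trans hgt.symm)
    have h1 := hone haA k hk
    have h0 := hnotMem k hkt
    rw [Finsupp.add_apply] at h0
    omega
  · obtain ⟨k, ⟨hk, hkt⟩, -⟩ := hB.2.2.2.2.1 t ht fun h => htQ ⟨f, hf, h.symm⟩
    have hbk : b' k = 0 := mem_support_notMem_vars_zero hb' fun h => htQ ⟨k, h, hkt⟩
    have h1 := hone hbB k hk
    have h0 := hnotMem k hkt
    rw [Finsupp.add_apply] at h0
    omega
end

section
/- Let G = (V, E) be a digraph rooted at v such that G[V∖{v}] is strongly connected and G has no non-trivial dominators. Then for every edge wu of G with u ≠ v and w ≠ v, there exists a simple directed cycle C containing the edge wu such that C has at least two independent vertices, one of which is w. -/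
open MvPolynomial

namespace MultiDigraph

section Walks

variable {V : Type*} {ε : Type*} {G : MultiDigraph V ε} {A : Finset ε}

theorem isWalk_append {p q : List ε} {x z : V} :
    G.IsWalk A (p ++ q) x z ↔ ∃ y, G.IsWalk A p x y ∧ G.IsWalk A q y z := by
  induction p generalizing x with
  | nil => simp [IsWalk]
  | cons e p ih => simp [IsWalk, ih, and_assoc]

theorem IsWalk.mem_support_iff {p : List ε} {x y : V} (h : G.IsWalk A p x y) (z : V) :
    z ∈ x :: p.map G.tgt ↔ z = y ∨ z ∈ p.map G.src := by
  induction p generalizing x with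
  | nil => simp_all [IsWalk]
  | cons e p ih =>
    obtain ⟨-, rfl, h⟩ := h
    rw [List.map_cons, List.mem_cons, ih h, List.map_cons, List.mem_cons]
    tauto

/-- Split a walk at its first vertex satisfying `P`. -/
theorem IsWalk.exists_split_first {p : List ε} {x y : V} (h : G.IsWalk A p x y) (P : V → Prop)
    (hP : ∃ z ∈ x :: p.map G.tgt, P z) :
    ∃ p₁ p₂ z, p = p₁ ++ p₂ ∧ G.IsWalk A p₁ x z ∧ G.IsWalk A p₂ z y ∧ P z ∧
      ∀ a ∈ p₁.map G.src, ¬ P a := by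
  induction p generalizing x with
  | nil => exact ⟨[], [], x, by simp_all [IsWalk]⟩
  | cons e p ih =>
    by_cases hx : P x
    · exact ⟨[], e :: p, x, rfl, rfl, h, hx, by simp⟩
    · obtain ⟨he, rfl, h⟩ := h
      obtain ⟨p₁, p₂, z, rfl, h₁, h₂, hz, hn⟩ := ih h (by
        obtain ⟨z, hz, hPz⟩ := hP
        rcases List.mem_cons.1 hz with rfl | hz
        · exact absurd hPz hx
        · exact ⟨z, hz, hPz⟩)
      exact ⟨e :: p₁, p₂, z, rfl, ⟨he, rfl, h₁⟩, h₂, hz, by simpa [hx] using hn⟩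

/-- Split a walk at its last vertex satisfying `P`. -/
theorem IsWalk.exists_split_last {p : List ε} {x y : V} (h : G.IsWalk A p x y) (P : V → Prop)
    (hP : ∃ z ∈ x :: p.map G.tgt, P z) :
    ∃ p₁ p₂ z, p = p₁ ++ p₂ ∧ G.IsWalk A p₁ x z ∧ G.IsWalk A p₂ z y ∧ P z ∧
      ∀ a ∈ p₂.map G.tgt, ¬ P a := by
  induction p generalizing x with
  | nil => exact ⟨[], [], x, by simp_all [IsWalk]⟩
  | cons e p ih =>
    by_cases hp : ∃ z ∈ (e :: p).map G.tgt, P z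
    · obtain ⟨he, rfl, h⟩ := h
      obtain ⟨p₁, p₂, z, rfl, h₁, h₂, hz, hn⟩ := ih h hp
      exact ⟨e :: p₁, p₂, z, rfl, ⟨he, rfl, h₁⟩, h₂, hz, hn⟩
    · obtain ⟨z, hz, hPz⟩ := hP
      rcases List.mem_cons.1 hz with rfl | hz
      · exact ⟨[], e :: p, z, rfl, rfl, h, hPz, fun a ha hPa => hp ⟨a, ha, hPa⟩⟩
      · exact absurd ⟨z, hz, hPz⟩ hp

/-- A walk can be shortcut to a path using only edges of the walk. -/
theorem IsWalk.exists_isPath {p : List ε} {x y : V} (h : G.IsWalk A p x y) :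
    ∃ q ⊆ p, G.IsPath A q x y := by
  induction p generalizing x with
  | nil => exact ⟨[], by simp, h, by simp⟩
  | cons e p ih =>
    obtain ⟨he, rfl, h⟩ := h
    obtain ⟨q, hqp, hq, hnd⟩ := ih h
    by_cases hx : G.src e ∈ G.tgt e :: q.map G.tgt
    · obtain ⟨q₁, q₂, z, rfl, -, h₂, rfl, hn⟩ :=
        hq.exists_split_last (· = G.src e) ⟨_, hx, rfl⟩
      refine ⟨q₂, fun a ha => by simp [hqp (List.mem_append_right q₁ ha)], h₂, ?_⟩
      rw [List.nodup_cons]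
      refine ⟨fun hz => hn _ hz rfl, ?_⟩
      rw [List.map_append] at hnd
      exact (List.nodup_append.1 (List.nodup_cons.1 hnd).2).2.1
    · exact ⟨e :: q, by grind, ⟨he, rfl, hq⟩, List.nodup_cons.2 ⟨hx, hnd⟩⟩

/-- `x` is the end of walks from `a` and from `b` that meet nowhere but in their last vertex. -/
def HasFan (G : MultiDigraph V ε) (A : Finset ε) (a b x : V) : Prop :=
  ∃ p q, G.IsWalk A p a x ∧ G.IsWalk A q b x ∧ x ∉ p.map G.src ∧ x ∉ q.map G.src ∧
    (p.map G.src).Disjoint (q.map G.src)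

theorem HasFan.symm {a b x : V} (h : G.HasFan A a b x) : G.HasFan A b a x := by
  obtain ⟨p, q, hp, hq, hxp, hxq, hd⟩ := h
  exact ⟨q, p, hq, hp, hxq, hxp, hd.symm⟩

/-- Rerouting a fan: extend the first leg by the edge `f` and replace the end of the second
leg by the detour `t`. -/
theorem HasFan.of_detour {a b x z : V} {p q t : List ε} {f : ε} (hf : f ∈ A)
    (hp : G.IsWalk A p a x) (hq : G.IsWalk A q b x) (hfx : G.src f = x)
    (hne : x ≠ G.tgt f) (hxq : x ∉ q.map G.src)
    (hd : (p.map G.src).Disjoint (q.map G.src)) (ht : G.IsWalk A t z (G.tgt f))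
    (hz : z ∈ q.map G.src) (hyp : G.tgt f ∉ p.map G.src)
    (hyt : G.tgt f ∉ t.map G.src) (hxt : x ∉ t.map G.src)
    (htp : ∀ c ∈ t.map G.tgt, c ∉ p.map G.src) :
    G.HasFan A a b (G.tgt f) := by
  obtain ⟨q₁, q₂, c, rfl, h₁, -, hc, hn⟩ :=
    hq.exists_split_first (fun c => c = z ∨ c = G.tgt f)
      ⟨z, (hq.mem_support_iff z).2 (Or.inr hz), Or.inl rfl⟩
  have hpf : G.IsWalk A (p ++ [f]) a (G.tgt f) :=
    isWalk_append.2 ⟨x, hp, hf, hfx, rfl⟩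
  have hts : ∀ c ∈ t.map G.src, c ∉ p.map G.src := by
    intro c hct
    rcases List.mem_cons.1 ((ht.mem_support_iff c).2 (Or.inr hct)) with rfl | h
    · exact fun h => hd h hz
    · exact htp c h
  simp only [List.map_append, List.Disjoint, List.mem_append] at *
  rcases hc with rfl | rfl
  · refine ⟨p ++ [f], q₁ ++ t, hpf, isWalk_append.2 ⟨c, h₁, ht⟩, ?_⟩
    simp only [List.map_append, List.mem_append, List.Disjoint, List.map_cons, List.map_nil,
      List.mem_singleton]
    grind
  · refine ⟨p ++ [f], q₁, hpf, h₁, ?_⟩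
    simp only [List.map_append, List.mem_append, List.Disjoint, List.map_cons, List.map_nil,
      List.mem_singleton]
    grind

/-- A fan to `x` can be pushed along an edge out of `x`, provided `x` does not separate `b`
from the target of that edge. -/
theorem HasFan.step {a b x : V} {f : ε} {t : List ε} (h : G.HasFan A a b x) (hf : f ∈ A)
    (hfx : G.src f = x) (hbx : b ≠ x) (hne : x ≠ G.tgt f)
    (ht : G.IsWalk A t b (G.tgt f)) (hxt : x ∉ b :: t.map G.tgt) :
    G.HasFan A a b (G.tgt f) := by
  obtain ⟨p, q, hp, hq, hxp, hxq, hd⟩ := h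
  by_cases hyp : G.tgt f ∈ p.map G.src
  · exact (HasFan.of_detour (t := []) hf hq hp hfx hne hxp hd.symm rfl hyp
      (fun h => hd hyp h) (by simp) (by simp) (by simp)).symm
  by_cases hyq : G.tgt f ∈ q.map G.src
  · exact HasFan.of_detour (t := []) hf hp hq hfx hne hxq hd rfl hyq hyp (by simp) (by simp)
      (by simp)
  obtain ⟨t₁, t₂, y, rfl, ht₁, -, rfl, hyt⟩ := ht.exists_split_first (· = G.tgt f)
    ⟨_, (ht.mem_support_iff _).2 (Or.inl rfl), rfl⟩
  have hb : b ∈ q.map G.src :=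
    ((hq.mem_support_iff b).1 List.mem_cons_self).resolve_left hbx
  obtain ⟨s₁, s₂, z, rfl, -, hs, hz, hn⟩ := ht₁.exists_split_last
    (fun c => c ∈ p.map G.src ∨ c ∈ q.map G.src) ⟨b, List.mem_cons_self, Or.inr hb⟩
  have hxs : x ∉ s₂.map G.src := by
    intro hx
    have := (ht₁.mem_support_iff x).2
      (Or.inr (by rw [List.map_append]; exact List.mem_append_right _ hx))
    grind
  have hys : G.tgt f ∉ s₂.map G.src := fun h =>
    hyt _ (by rw [List.map_append]; exact List.mem_append_right _ h) rfl
  rcases hz with hz | hz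
  · exact (HasFan.of_detour hf hq hp hfx hne hxp hd.symm hs hz hyq hys hxs
      fun c hc h => hn c hc (Or.inr h)).symm
  · exact HasFan.of_detour hf hp hq hfx hne hxq hd hs hz hyp hys hxs
      fun c hc h => hn c hc (Or.inl h)

end Walks

end MultiDigraph

open MvPolynomial

variable {V : Type*} {ε : Type*} [DecidableEq V] [DecidableEq ε]

/-- Let `G` be rooted at `v` with `G[V∖{v}]` strongly connected and no
non-trivial dominators.  Then every edge `wu` with `u ≠ v` and `w ≠ v` lies on a simple
directed cycle having at least two independent vertices, one of which is `w`. -/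
theorem statement_5 (G : MultiDigraph V ε) (hwf : G.WellFormed) (hsimple : G.Simple)
    (v : V) (hroot : G.RootedAt v)
    (hsc : (G.induce (G.verts.erase v)).StronglyConnected)
    (hdom : ∀ u ∈ G.verts, u ≠ v → ∀ w ∈ G.verts, G.Dominates v u w → w = u)
    (e₀ : ε) (he : e₀ ∈ G.edges) (hsrc : G.src e₀ ≠ v) (htgt : G.tgt e₀ ≠ v) :
    ∃ (C : List ε) (x : V), G.IsCycle G.edges C x ∧ e₀ ∈ C ∧
      G.IsIndependentVertex v C (G.src e₀) ∧
      ∃ z, z ≠ G.src e₀ ∧ G.IsIndependentVertex v C z := by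
  have avoid : ∀ x ∈ G.verts, x ≠ v → ∀ y ∈ G.verts, x ≠ y →
      ∃ p, G.IsPath G.edges p v y ∧ x ∉ v :: p.map G.tgt := by
    intro x hx hxv y hy hxy
    by_contra! h
    exact hxy (hdom x hx hxv y hy h).symm
  obtain ⟨hw, hu⟩ := hwf e₀ he
  obtain ⟨r, ⟨hr, hrnd⟩, hwr⟩ := avoid _ hw hsrc _ hu (hsimple.1 e₀ he)
  have fan : G.HasFan G.edges (G.tgt e₀) v (G.src e₀) := by
    have hreach := hsc _ (Finset.mem_erase.2 ⟨htgt, hu⟩) _ (Finset.mem_erase.2 ⟨hsrc, hw⟩)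
    have key : ∀ x, (G.induce (G.verts.erase v)).Reaches (G.induce (G.verts.erase v)).edges
        (G.tgt e₀) x → G.HasFan G.edges (G.tgt e₀) v x := by
      intro x hx
      induction hx with
      | refl =>
        obtain ⟨r₁, -, y, -, hr₁, -, rfl, hn⟩ := hr.exists_split_first (· = G.tgt e₀)
          ⟨_, (hr.mem_support_iff _).2 (Or.inl rfl), rfl⟩
        exact ⟨[], r₁, rfl, hr₁, by simp, fun h => hn _ h rfl, by simp⟩
      | tail _ hstep ih =>
        obtain ⟨f, hf, rfl, rfl⟩ := hstep
        obtain ⟨hf, hfs, hft⟩ := Finset.mem_filter.1 hf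
        obtain ⟨hsv, hs⟩ := Finset.mem_erase.1 hfs
        obtain ⟨t, ht, hxt⟩ := avoid _ hs hsv _ (Finset.mem_erase.1 hft).2 (hsimple.1 f hf)
        exact ih.step hf rfl hsv.symm (hsimple.1 f hf) ht.1 hxt
    exact key _ hreach
  obtain ⟨q, p, hq, hp, -, -, hd⟩ := fan
  obtain ⟨q', hqq, hq', hqnd⟩ := hq.exists_isPath
  obtain ⟨p', hpp, hp', hpnd⟩ := hp.exists_isPath
  have hwC : G.src e₀ ∈ (e₀ :: q').map G.tgt := (hq'.mem_support_iff _).2 (Or.inl rfl)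
  refine ⟨e₀ :: q', G.src e₀, ⟨by simp, ⟨he, rfl, hq'⟩, hqnd⟩, by simp,
    ⟨hwC, p', ⟨hp', hpnd⟩, ?_⟩, ?_⟩
  · intro z hzp hzq
    rcases (hp'.mem_support_iff z).1 hzp with rfl | hzp
    · rfl
    rcases (hq'.mem_support_iff z).1 hzq with rfl | hzq
    · rfl
    exact absurd (List.map_subset _ hpp hzp) (hd (List.map_subset _ hqq hzq))
  · obtain ⟨r₁, r₂, z, rfl, hr₁, -, hz, hn⟩ := hr.exists_split_first
      (· ∈ (e₀ :: q').map G.tgt) ⟨_, (hr.mem_support_iff _).2 (Or.inl rfl), by simp⟩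
    rw [List.map_append, ← List.cons_append] at hrnd hwr
    refine ⟨z, ?_, hz, r₁, ⟨hr₁, (List.nodup_append.1 hrnd).1⟩, ?_⟩
    · rintro rfl
      exact hwr (List.mem_append_left _ ((hr₁.mem_support_iff _).2 (Or.inl rfl)))
    · intro c hc hcC
      exact ((hr₁.mem_support_iff c).1 hc).resolve_right fun h => hn c h hcC
end

section
/- Let G = (V, E) be a digraph rooted at v such that G[V∖{v}] is strongly connected and G has no non-trivial dominators, and let V₁, V₂ be a partition of V∖{v} into two nonempty sets. Then there exists a simple directed cycle in G having an independent vertex belonging to V₁ and an independent vertex belonging to V₂. -/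
open MvPolynomial

section RestrictedReachability

variable {α : Type*} {R : α → α → Prop} {S X Y : Set α}

/-- `y` is reachable from `S` along `R`-steps all of whose vertices, endpoints included, lie in `X`. -/
inductive ReachIn (R : α → α → Prop) (S X : Set α) : α → Prop
  | base {s : α} : s ∈ S → s ∈ X → ReachIn R S X s
  | step {y z : α} : ReachIn R S X y → R y z → z ∈ X → ReachIn R S X z

namespace ReachIn

theorem mem {y : α} (h : ReachIn R S X y) : y ∈ X := by
  cases h <;> assumption

theorem mono {y : α} (hXY : X ⊆ Y) (h : ReachIn R S X y) : ReachIn R S Y y := by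
  induction h with
  | base hs hx => exact .base hs (hXY hx)
  | step _ hR hz ih => exact .step ih hR (hXY hz)

theorem trans {y z : α} (h : ReachIn R S X y) (h' : ReachIn R {y} X z) : ReachIn R S X z := by
  induction h' with
  | base hs _ => rw [Set.mem_singleton_iff] at hs; exact hs ▸ h
  | step _ hR hz ih => exact .step ih hR hz

theorem head {y z w : α} (hR : R y z) (hy : y ∈ X) (h : ReachIn R {z} X w) :
    ReachIn R {y} X w := by
  have hz : z ∈ X := by
    induction h with
    | base hs hx => exact hs ▸ hx
    | step _ _ _ ih => exact ih
  have hy' : ReachIn R {y} X y := .base rfl hy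
  exact (hy'.step hR hz).trans h

theorem exists_source {y : α} (h : ReachIn R S X y) : ∃ s ∈ S, s ∈ X := by
  induction h with
  | base hs hx => exact ⟨_, hs, hx⟩
  | step _ _ _ ih => exact ih

/-- A walk from `S` within `X` stays among the vertices reachable from `S` within `X`. -/
theorem within_reachable {y : α} (h : ReachIn R S X y) :
    ReachIn R S {z | ReachIn R S X z} y := by
  induction h with
  | base hs hx => exact .base hs (ReachIn.base hs hx)
  | step hy hR hz ih => exact .step ih hR (ReachIn.step hy hR hz)

/-- The vertices of a walk to `b` can be chosen among those that reach `b`. -/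
theorem within_coreachable {b y : α} (h : ReachIn R S X y) (hb : ReachIn R {y} X b) :
    ReachIn R S {z | ReachIn R {z} X b} y := by
  induction h with
  | base hs _ => exact .base hs hb
  | step hy hR _ ih => exact .step (ih (head hR hy.mem hb)) hR hb

theorem insert_reachable {x : α} {A : Set α} (hx : x ∉ A) (h : ReachIn R S (insert x A) x) :
    ReachIn R S (insert x {z | ReachIn R S A z}) x := by
  have key : ∀ y, ReachIn R S (insert x A) y →
      ReachIn R S (insert x {z | ReachIn R S A z}) x ∨ ReachIn R S A y := by
    intro y hy
    induction hy with
    | base hs hy =>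
      rcases hy with rfl | hy
      · exact .inl (.base hs (.inl rfl))
      · exact .inr (.base hs hy)
    | step _ hR hz ih =>
      rcases ih with ih | ih
      · exact .inl ih
      rcases hz with rfl | hz
      · exact .inl (.step (ih.within_reachable.mono fun _ h => .inr h) hR (.inl rfl))
      · exact .inr (.step ih hR hz)
  exact (key x h).resolve_right fun h' => hx h'.mem

/-- A walk either avoids `H` or has a first vertex in `H`. -/
theorem avoid_or_first_hit {H : Set α} {b t : α} (hb : b ∉ H) (h : ReachIn R {b} X t) :
    ReachIn R {b} Hᶜ t ∨ ∃ y z, ReachIn R {b} Hᶜ y ∧ R y z ∧ z ∈ H := by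
  induction h with
  | base hs _ => rw [Set.mem_singleton_iff] at hs; subst hs; exact .inl (.base rfl hb)
  | @step y z _ hR _ ih =>
    rcases ih with ih | ih
    · by_cases hz : z ∈ H
      · exact .inr ⟨y, z, ih, hR, hz⟩
      · exact .inl (.step ih hR hz)
    · exact .inr ih

theorem exists_last_step {z b : α} (hzb : z ≠ b) (h : ReachIn R {z} X b) :
    ∃ y, ReachIn R {z} X y ∧ R y b := by
  cases h with
  | base hs _ => exact absurd hs.symm hzb
  | step hy hR _ => exact ⟨_, hy, hR⟩

end ReachIn

/-- `b` is reachable from `S` along two walks sharing no vertex but `b`. -/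
def HasDisjointWalks (R : α → α → Prop) (S : Set α) (b : α) : Prop :=
  ∃ A B : Set α, Disjoint A B ∧ b ∉ A ∧ b ∉ B ∧
    ReachIn R S (insert b A) b ∧ ReachIn R S (insert b B) b

theorem HasDisjointWalks.step {x b : α} (h : HasDisjointWalks R S x) (hR : R x b)
    (hb : ReachIn R S {x}ᶜ b) : HasDisjointWalks R S b := by
  obtain ⟨A₀, B₀, hd, hxA, hxB, hA, hB⟩ := h
  set A := {z | ReachIn R S A₀ z} with hAdef
  set B := {z | ReachIn R S B₀ z} with hBdef
  have hAA : A ⊆ A₀ := fun _ h => h.mem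
  have hBB : B ⊆ B₀ := fun _ h => h.mem
  have hAx := hA.insert_reachable hxA
  have hBx := hB.insert_reachable hxB
  have hdAB : Disjoint A B := hd.mono hAA hBB
  have key : ∀ y, ReachIn R S {x}ᶜ y →
      ∃ T, x ∉ T ∧ ReachIn R S T y ∧ (Disjoint T A ∨ Disjoint T B) := by
    intro y hy
    induction hy with
    | @base s hs hsx =>
      by_cases hsA : s ∈ A
      · exact ⟨A, fun h => hxA (hAA h), .base hs hsA, .inr hdAB⟩
      · exact ⟨{s}, fun h => hsx h.symm, .base hs rfl, .inl (by simpa using hsA)⟩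
    | @step y z _ hyz hz ih =>
      obtain ⟨T, hxT, hT, hTd⟩ := ih
      by_cases hzA : z ∈ A
      · exact ⟨A, fun h => hxA (hAA h), ReachIn.within_reachable hzA, .inr hdAB⟩
      by_cases hzB : z ∈ B
      · exact ⟨B, fun h => hxB (hBB h), ReachIn.within_reachable hzB, .inl hdAB.symm⟩
      refine ⟨insert z T, ?_, (hT.mono (Set.subset_insert _ _)).step hyz (.inl rfl), ?_⟩
      · rintro (rfl | h)
        · exact hz rfl
        · exact hxT h
      · simpa [Set.disjoint_insert_left, hzA, hzB] using hTd
  obtain ⟨T, hxT, hT, hTd⟩ := key b hb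
  have finish : ∀ D : Set α, ReachIn R S (insert x D) x → Disjoint T D →
      HasDisjointWalks R S b := by
    intro D hD hTD
    have hbT := hT.mem
    refine ⟨T \ {b}, insert x D, ?_, by simp, ?_, by simpa [Set.insert_eq_of_mem hbT] using hT,
      (hD.mono (Set.subset_insert _ _)).step hR (.inl rfl)⟩
    · rw [Set.disjoint_insert_right]
      exact ⟨fun h => hxT h.1, hTD.mono_left Set.sdiff_subset⟩
    · rintro (rfl | h)
      · exact hxT hbT
      · exact Set.disjoint_left.1 hTD hbT h
  exact hTd.elim (finish A hAx) (finish B hBx)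

/-- If no single vertex separates any vertex of `W` from the source set `S`, then every vertex
reachable from `S` is reachable along two disjoint walks. -/
theorem ReachIn.hasDisjointWalks {W : Set α} (hirr : ∀ x, ¬ R x x)
    (hmem : ∀ x y, R x y → x ∈ W ∧ y ∈ W)
    (hdom : ∀ u ∈ W, ∀ w ∈ W, w ≠ u → ReachIn R S {u}ᶜ w) {b : α} (h : ReachIn R S X b) :
    HasDisjointWalks R S b := by
  induction h with
  | base hs _ =>
    exact ⟨∅, ∅, by simp, by simp, by simp, .base hs (.inl rfl), .base hs (.inl rfl)⟩
  | @step y z _ hR _ ih =>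
    obtain ⟨hy, hz⟩ := hmem _ _ hR
    exact ih.step hR (hdom y hy z hz fun h => hirr y (h ▸ hR))

/-- `a :: l` lists the vertices of a simple directed cycle of `R` in cyclic order. -/
def IsVertexCycle (R : α → α → Prop) (a : α) (l : List α) : Prop :=
  (a :: l ++ [a]).IsChain R ∧ (a :: l).Nodup

theorem IsVertexCycle.exists_rotate {a c : α} {l : List α} (h : IsVertexCycle R a l)
    (hc : c ∈ a :: l) :
    ∃ l', IsVertexCycle R c l' ∧ ∀ x, x ∈ c :: l' ↔ x ∈ a :: l := by
  rcases List.mem_cons.1 hc with rfl | hc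
  · exact ⟨l, h, fun _ => Iff.rfl⟩
  obtain ⟨l₁, l₂, rfl⟩ := List.append_of_mem hc
  obtain ⟨hch, hnd⟩ := h
  refine ⟨l₂ ++ a :: l₁, ⟨?_, ?_⟩, ?_⟩
  · have h₁ : (a :: l₁ ++ [c]).IsChain R ∧ (c :: (l₂ ++ [a])).IsChain R :=
      List.isChain_split.1 (by simpa using hch)
    have h₂ : (c :: l₂ ++ a :: (l₁ ++ [c])).IsChain R :=
      List.isChain_split.2 ⟨by simpa using h₁.2, by simpa using h₁.1⟩
    simpa using h₂
  · exact (List.Perm.nodup_iff (by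
      simpa using (List.perm_append_comm (l₁ := c :: l₂) (l₂ := a :: l₁)))).2 hnd
  · intro x
    simp only [List.mem_cons, List.mem_append]
    tauto

theorem List.IsChain.reachIn {a z : α} {l : List α} (h : (a :: l).IsChain R)
    (hX : ∀ x ∈ a :: l, x ∈ X) (hz : z ∈ a :: l) : ReachIn R {a} X z := by
  induction l generalizing a with
  | nil =>
    obtain rfl : z = a := by simpa using hz
    exact .base rfl (hX z (by simp))
  | cons c l ih =>
    rcases List.mem_cons.1 hz with rfl | hz
    · exact .base rfl (hX z (by simp))
    · rw [List.isChain_cons_cons] at h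
      exact ReachIn.head h.1 (hX a (by simp))
        (ih h.2 (fun x hx => hX x (List.mem_cons_of_mem _ hx)) hz)

theorem IsVertexCycle.reachIn {a e z : α} {l : List α} (h : IsVertexCycle R a l)
    (he : e ∈ a :: l) (hz : z ∈ a :: l) : ReachIn R {e} {x | x ∈ a :: l} z := by
  obtain ⟨l', ⟨hch, -⟩, hmem⟩ := h.exists_rotate he
  exact hch.left_of_append.reachIn (fun x hx => (hmem x).1 hx) ((hmem z).2 hz)

/-- A vertex reachable from the first vertex of a simple path `e :: m` is the end of a simple path
which first follows `e :: m` and then avoids it. -/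
theorem ReachIn.exists_path {e f : α} {m : List α} (hch : (e :: m).IsChain R)
    (hnd : (e :: m).Nodup) (hX : ∀ x ∈ e :: m, x ∈ X) (h : ReachIn R {e} X f) :
    ∃ m₁ m₂ t : List α, m = m₁ ++ m₂ ∧ (e :: m₁ ++ t).IsChain R ∧ t.Nodup ∧
      (∀ x ∈ t, x ∈ X ∧ x ∉ e :: m) ∧ (e :: m₁ ++ t).getLast? = some f := by
  induction h with
  | base hs _ =>
    rw [Set.mem_singleton_iff] at hs
    subst hs
    exact ⟨[], m, [], by simp⟩
  | @step y z hy hR hz ih =>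
    by_cases hzm : z ∈ e :: m
    · rcases List.mem_cons.1 hzm with rfl | hzm
      · exact ⟨[], m, [], by simp⟩
      obtain ⟨l₁, l₂, rfl⟩ := List.append_of_mem hzm
      refine ⟨l₁ ++ [z], l₂, [], by simp, ?_, by simp, by simp, ?_⟩
      · have := (List.isChain_split (l₁ := e :: l₁)).1 hch
        simpa using this.1
      · rw [List.append_nil, ← List.cons_append, List.getLast?_concat]
    obtain ⟨m₁, m₂, t, rfl, htc, htn, htX, htl⟩ := ih
    by_cases hzt : z ∈ t
    · obtain ⟨t₁, t₂, rfl⟩ := List.append_of_mem hzt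
      refine ⟨m₁, m₂, t₁ ++ [z], rfl, ?_, ?_, ?_, ?_⟩
      · have := (List.isChain_split (l₁ := e :: m₁ ++ t₁)).1 (by simpa using htc)
        simpa using this.1
      · exact htn.sublist (by simp)
      · intro x hx
        exact htX x (by simp only [List.mem_append, List.mem_cons] at hx ⊢; grind)
      · rw [← List.append_assoc, List.getLast?_concat]
    · refine ⟨m₁, m₂, t ++ [z], rfl, ?_, ?_, ?_, ?_⟩
      · rw [← List.append_assoc, List.isChain_append]
        refine ⟨htc, by simp, ?_⟩
        rw [htl]
        simpa using hR
      · rw [List.nodup_append]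
        refine ⟨htn, by simp, ?_⟩
        intro a ha b hb
        obtain rfl : b = z := by simpa using hb
        rintro rfl
        exact hzt ha
      · intro x hx
        rcases List.mem_append.1 hx with hx | hx
        · exact htX x hx
        · obtain rfl : x = z := by simpa using hx
          exact ⟨hz, hzm⟩
      · rw [← List.append_assoc, List.getLast?_concat]

theorem ReachIn.exists_simple_path {e f : α} (h : ReachIn R {e} X f) :
    ∃ t : List α, (e :: t).IsChain R ∧ (e :: t).Nodup ∧ (∀ x ∈ t, x ∈ X) ∧
      (e :: t).getLast? = some f := by
  have he : e ∈ X := by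
    obtain ⟨s, hs, hsX⟩ := h.exists_source
    exact hs ▸ hsX
  obtain ⟨m₁, m₂, t, hm, hc, hn, htX, hl⟩ :=
    h.exists_path (m := []) (by simp) (by simp) (by simpa using he)
  obtain ⟨rfl, rfl⟩ := List.append_eq_nil_iff.1 hm.symm
  refine ⟨t, by simpa using hc, List.nodup_cons.2 ⟨fun h => (htX e h).2 (by simp), hn⟩,
    fun x hx => (htX x hx).1, by simpa using hl⟩

/-- `x` lies on the cycle with vertex set `K` and is reachable from `S` along a walk that meets the
cycle only in `x`. -/
def IsEntry (R : α → α → Prop) (S K : Set α) (x : α) : Prop :=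
  x ∈ K ∧ ReachIn R S (insert x Kᶜ) x

theorem exists_cycle_of_closed_walk {b y : α} (h : ReachIn R {b} X y) (hR : R y b) :
    ∃ l, IsVertexCycle R b l ∧ ∀ x ∈ b :: l, x = b ∨ x ∈ X := by
  obtain ⟨t, hc, hn, htX, hl⟩ := h.exists_simple_path
  refine ⟨t, ⟨?_, hn⟩, ?_⟩
  · rw [List.isChain_append]
    refine ⟨hc, by simp, ?_⟩
    rw [hl]
    simpa using hR
  · intro x hx
    exact (List.mem_cons.1 hx).imp_right (htX x)

/-- A digraph `R` on the vertex set `W`, together with the set `S` of out-neighbours of an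
external root, that is strongly connected and has no non-trivial dominators. -/
structure IsUndominated (R : α → α → Prop) (S W : Set α) : Prop where
  irrefl : ∀ x, ¬ R x x
  mem : ∀ x y, R x y → x ∈ W ∧ y ∈ W
  source_mem : S ⊆ W
  strong : ∀ x ∈ W, ∀ y ∈ W, ReachIn R {x} Set.univ y
  reach : ∀ u ∈ W, ∀ w ∈ W, w ≠ u → ReachIn R S {u}ᶜ w

theorem IsUndominated.exists_cycle_entry {W : Set α} (h : IsUndominated R S W) {b c : α}
    (hb : b ∈ W) (hc : c ∈ W) (hcb : c ≠ b) :
    ∃ l, IsVertexCycle R b l ∧ IsEntry R S {x | x ∈ b :: l} b := by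
  by_cases hbS : b ∈ S
  · obtain ⟨y, -, hyb⟩ := (h.strong c hc b hb).exists_last_step hcb
    obtain ⟨l, hl, -⟩ := exists_cycle_of_closed_walk (h.strong b hb y (h.mem _ _ hyb).1) hyb
    exact ⟨l, hl, by simp, .base hbS (.inl rfl)⟩
  obtain ⟨A, B, hd, hbA, hbB, hA, hB⟩ :=
    (h.reach c hc b hb hcb.symm).hasDisjointWalks h.irrefl h.mem h.reach
  -- the vertices of `D` lying on walks to `b` within `D`
  let core : Set α → Set α := fun D => {z | z ∈ D ∧ ReachIn R {z} (insert b D) b}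
  have hcore : ∀ D, ReachIn R S (insert b D) b → ReachIn R S (insert b (core D)) b := by
    intro D hD
    refine (hD.within_coreachable (.base rfl hD.mem)).mono ?_
    intro z hz
    obtain ⟨s, hs, hsD⟩ := ReachIn.exists_source hz
    rw [Set.mem_singleton_iff] at hs
    subst hs
    exact hsD.imp_right fun h => ⟨h, hz⟩
  have finish : ∀ A B, Disjoint A B → b ∉ A → b ∉ B → ReachIn R S (insert b B) b →
      ∀ y z, ReachIn R {b} (core B)ᶜ y → R y z → z ∈ core A →
      ∃ l, IsVertexCycle R b l ∧ IsEntry R S {x | x ∈ b :: l} b := by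
    intro A B hd hbA hbB hB y z hy hyz hz
    have hAB : insert b A ⊆ (core B)ᶜ := by
      rintro x (rfl | hx) hxB
      · exact hbB hxB.1
      · exact Set.disjoint_left.1 hd hx hxB.1
    have hzb : z ≠ b := fun e => hbA (e ▸ hz.1)
    obtain ⟨w, hzw, hwb⟩ := hz.2.exists_last_step hzb
    have hbw : ReachIn R {b} (core B)ᶜ w :=
      (hy.step hyz (hAB (.inr hz.1))).trans (hzw.mono hAB)
    obtain ⟨l, hl, hlX⟩ := exists_cycle_of_closed_walk hbw hwb
    refine ⟨l, hl, by simp, (hcore B hB).mono ?_⟩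
    rintro x (rfl | hx)
    · exact .inl rfl
    · refine .inr fun hxl => ?_
      rcases hlX x hxl with rfl | h'
      · exact hbB hx.1
      · exact h' hx
  obtain ⟨s, hs, hsB⟩ := (hcore B hB).exists_source
  have hsB : s ∈ core B := hsB.resolve_left fun e => hbS (e ▸ hs)
  have hbH : b ∉ core A ∪ core B := by
    rintro (h | h)
    · exact hbA h.1
    · exact hbB h.1
  rcases (h.strong b hb s (h.source_mem hs)).avoid_or_first_hit hbH with h' | ⟨y, z, hy, hyz, hz⟩
  · exact absurd (.inr hsB) h'.mem
  rcases hz with hz | hz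
  · exact finish A B hd hbA hbB hB y z
      (hy.mono (Set.compl_subset_compl.2 Set.subset_union_right)) hyz hz
  · exact finish B A hd.symm hbB hbA hA y z
      (hy.mono (Set.compl_subset_compl.2 Set.subset_union_left)) hyz hz

section Contraction

variable {U : Set α} {b : α}

open Classical in
/-- The map sending all of `U` to `b` and fixing every other vertex. -/
noncomputable def collapseTo (U : Set α) (b x : α) : α :=
  if x ∈ U then b else x

/-- The loopless digraph obtained from `R` by contracting `U` to `b`. -/
def Contracted (R : α → α → Prop) (U : Set α) (b x y : α) : Prop :=
  x ≠ y ∧ ∃ x' y', collapseTo U b x' = x ∧ collapseTo U b y' = y ∧ R x' y'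

theorem collapseTo_of_mem {x : α} (hx : x ∈ U) : collapseTo U b x = b := if_pos hx

theorem collapseTo_of_notMem {x : α} (hx : x ∉ U) : collapseTo U b x = x := if_neg hx

theorem collapseTo_eq_iff_mem (hb : b ∈ U) {x : α} : collapseTo U b x = b ↔ x ∈ U := by
  refine ⟨fun h => ?_, collapseTo_of_mem⟩
  by_contra hx
  rw [collapseTo_of_notMem hx] at h
  exact hx (h ▸ hb)

theorem eq_of_collapseTo_eq {x z : α} (h : collapseTo U b x = z) (hz : z ≠ b) : x = z ∧ z ∉ U := by
  by_cases hx : x ∈ U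
  · exact absurd ((collapseTo_of_mem hx).symm.trans h).symm hz
  · rw [collapseTo_of_notMem hx] at h
    exact ⟨h, h ▸ hx⟩

theorem Contracted.of_ne {x y : α} (h : Contracted R U b x y) (hx : x ≠ b) (hy : y ≠ b) :
    R x y := by
  obtain ⟨-, x', y', hx', hy', hR⟩ := h
  rwa [(eq_of_collapseTo_eq hx' hx).1, (eq_of_collapseTo_eq hy' hy).1] at hR

theorem ReachIn.map_collapseTo {y : α} (h : ReachIn R S X y) (hXY : ∀ x ∈ X, collapseTo U b x ∈ Y) :
    ReachIn (Contracted R U b) (collapseTo U b '' S) Y (collapseTo U b y) := by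
  induction h with
  | base hs hx => exact .base ⟨_, hs, rfl⟩ (hXY _ hx)
  | @step y z _ hR hz ih =>
    by_cases hyz : collapseTo U b y = collapseTo U b z
    · exact hyz ▸ ih
    · exact .step ih ⟨hyz, y, z, rfl, rfl, hR⟩ (hXY _ hz)

variable {P : α → Prop}

/-- Walks of a contraction lift, provided every vertex `e` where `U` can be entered satisfies a
property `P` ensuring that all of `U` is reachable from `e` inside `U`. -/
theorem ReachIn.lift (hb : b ∈ U) (hS : ∀ s ∈ S, s ∈ U → P s)
    (hin : ∀ x y, x ∉ U → y ∈ U → R x y → P y)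
    (hspread : ∀ e, P e → ∀ z ∈ U, ReachIn R {e} U z) {y : α}
    (h : ReachIn (Contracted R U b) (collapseTo U b '' S) Y y) :
    ∀ z, collapseTo U b z = y → ReachIn R S (collapseTo U b ⁻¹' Y) z := by
  have hUY : b ∈ Y → U ⊆ collapseTo U b ⁻¹' Y := by
    intro hbY x hx
    rwa [Set.mem_preimage, collapseTo_of_mem hx]
  induction h with
  | base hs hy =>
    obtain ⟨s, hs, rfl⟩ := hs
    intro z hz
    have hs' : ReachIn R S (collapseTo U b ⁻¹' Y) s := .base hs hy
    by_cases hzU : z ∈ U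
    · rw [collapseTo_of_mem hzU] at hz
      have hsU := (collapseTo_eq_iff_mem hb).1 hz.symm
      exact hs'.trans ((hspread s (hS s hs hsU) z hzU).mono (hUY (hz ▸ hy)))
    · rw [collapseTo_of_notMem hzU] at hz
      have : s = z := (eq_of_collapseTo_eq hz.symm fun h => hzU (h ▸ hb)).1
      exact this ▸ hs'
  | @step y w _ hR hw ih =>
    obtain ⟨hne, x', w', rfl, rfl, hR⟩ := hR
    intro z hz
    have hw' : ReachIn R S (collapseTo U b ⁻¹' Y) w' := .step (ih x' rfl) hR hw
    by_cases hzU : z ∈ U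
    · rw [collapseTo_of_mem hzU] at hz
      have hwU := (collapseTo_eq_iff_mem hb).1 hz.symm
      have hxU : x' ∉ U := fun hx => hne ((collapseTo_of_mem hx).trans hz)
      exact hw'.trans ((hspread w' (hin x' w' hxU hwU hR) z hzU).mono (hUY (hz ▸ hw)))
    · rw [collapseTo_of_notMem hzU] at hz
      have : w' = z := (eq_of_collapseTo_eq hz.symm fun h => hzU (h ▸ hb)).1
      exact this ▸ hw'

/-- A walk of a contraction that ends in `b` lifts to a walk that ends as soon as it enters `U`. -/
theorem ReachIn.lift_to_entrance (hb : b ∈ U) (hS : ∀ s ∈ S, s ∈ U → P s)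
    (hin : ∀ x y, x ∉ U → y ∈ U → R x y → P y)
    (hspread : ∀ e, P e → ∀ z ∈ U, ReachIn R {e} U z) (hbY : b ∉ Y)
    (h : ReachIn (Contracted R U b) (collapseTo U b '' S) (insert b Y) b) :
    ∃ e, P e ∧ e ∈ U ∧ ReachIn R S (insert e (collapseTo U b ⁻¹' Y)) e := by
  have key : ∀ y, ReachIn (Contracted R U b) (collapseTo U b '' S) (insert b Y) y →
      (∃ e, P e ∧ e ∈ U ∧ ReachIn R S (insert e (collapseTo U b ⁻¹' Y)) e) ∨
        ReachIn (Contracted R U b) (collapseTo U b '' S) Y y := by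
    intro y hy
    induction hy with
    | base hs hy =>
      rcases hy with rfl | hy
      · obtain ⟨s, hs, hsb⟩ := hs
        have hsU := (collapseTo_eq_iff_mem hb).1 hsb
        exact .inl ⟨s, hS s hs hsU, hsU, .base hs (.inl rfl)⟩
      · exact .inr (.base hs hy)
    | @step y z _ hR hz ih =>
      rcases ih with ih | ih
      · exact .inl ih
      rcases hz with rfl | hz
      · obtain ⟨hne, x', e, hx', he, hR'⟩ := hR
        have heU := (collapseTo_eq_iff_mem hb).1 he
        have hxU : x' ∉ U := fun hx => hne (hx'.symm.trans (collapseTo_of_mem hx))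
        exact .inl ⟨e, hin x' e hxU heU hR', heU,
          .step ((ih.lift hb hS hin hspread x' hx').mono (Set.subset_insert _ _)) hR' (.inl rfl)⟩
      · exact .inr (.step ih hR hz)
  exact (key b h).resolve_right fun h' => hbY h'.mem

end Contraction

section Shadow

variable {W C : Set α}

/-- The vertices of `W` all of whose walks from `S` meet `C`. -/
def shadow (R : α → α → Prop) (S W C : Set α) : Set α :=
  {x | x ∈ W ∧ ¬ ReachIn R S Cᶜ x}

theorem subset_shadow (hC : C ⊆ W) : C ⊆ shadow R S W C :=
  fun _ hx => ⟨hC hx, fun h => h.mem hx⟩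

theorem isEntry_of_source_mem_shadow {s : α} (hs : s ∈ S) (h : s ∈ shadow R S W C) :
    IsEntry R S C s :=
  ⟨by_contra fun hsC => h.2 (.base hs hsC), .base hs (.inl rfl)⟩

theorem isEntry_of_enters_shadow (hmem : ∀ x y, R x y → x ∈ W ∧ y ∈ W) {x y : α}
    (hx : x ∉ shadow R S W C) (hy : y ∈ shadow R S W C) (hR : R x y) : IsEntry R S C y := by
  have hxr : ReachIn R S Cᶜ x := by_contra fun h => hx ⟨(hmem _ _ hR).1, h⟩
  exact ⟨by_contra fun hyC => hy.2 (hxr.step hR hyC),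
    (hxr.mono (Set.subset_insert _ _)).step hR (.inl rfl)⟩

theorem ReachIn.avoids_shadow {x : α} (h : ReachIn R S Cᶜ x) :
    ReachIn R S (shadow R S W C)ᶜ x :=
  h.within_reachable.mono fun _ hz hz' => hz'.2 hz

theorem reachIn_shadow (hmem : ∀ x y, R x y → x ∈ W ∧ y ∈ W) (hCW : C ⊆ W)
    (hC : ∀ x ∈ C, ∀ y ∈ C, ReachIn R {x} C y) {e z : α} (he : e ∈ C)
    (hz : ReachIn R S X z) (hzU : z ∈ shadow R S W C) :
    ReachIn R {e} (shadow R S W C) z := by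
  induction hz with
  | base hs _ =>
    exact (hC e he _ (isEntry_of_source_mem_shadow hs hzU).1).mono (subset_shadow hCW)
  | @step y z _ hR _ ih =>
    by_cases hy : y ∈ shadow R S W C
    · exact (ih hy).step hR hzU
    · exact (hC e he _ (isEntry_of_enters_shadow hmem hy hzU hR).1).mono (subset_shadow hCW)

theorem IsUndominated.contract_shadow (h : IsUndominated R S W) {b : α} (hb : b ∈ C)
    (hCW : C ⊆ W) :
    IsUndominated (Contracted R (shadow R S W C) b) (collapseTo (shadow R S W C) b '' S)
      (collapseTo (shadow R S W C) b '' W) where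
  irrefl _ hx := hx.1 rfl
  mem := by
    rintro x y ⟨-, x', y', rfl, rfl, hR⟩
    exact ⟨⟨_, (h.mem _ _ hR).1, rfl⟩, ⟨_, (h.mem _ _ hR).2, rfl⟩⟩
  source_mem := Set.image_mono h.source_mem
  strong := by
    rintro _ ⟨x, hx, rfl⟩ _ ⟨y, hy, rfl⟩
    simpa using (h.strong x hx y hy).map_collapseTo (U := shadow R S W C) (b := b) (Y := Set.univ)
      fun _ _ => trivial
  reach := by
    have hbU := subset_shadow (R := R) (S := S) hCW hb
    rintro _ ⟨u, hu, rfl⟩ _ ⟨w, hw, rfl⟩ hwu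
    by_cases huU : u ∈ shadow R S W C
    · rw [collapseTo_of_mem huU] at hwu ⊢
      have hwU : w ∉ shadow R S W C := fun hw' => hwu (collapseTo_of_mem hw')
      have hwr : ReachIn R S Cᶜ w := by_contra fun h' => hwU ⟨hw, h'⟩
      exact hwr.avoids_shadow.map_collapseTo fun x hx hxb => hx ((collapseTo_eq_iff_mem hbU).1 hxb)
    · rw [collapseTo_of_notMem huU] at hwu ⊢
      have hub : u ≠ b := fun e => huU (e ▸ hbU)
      have hwu' : w ≠ u := by
        rintro rfl
        exact hwu (collapseTo_of_notMem huU)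
      exact (h.reach u hu w hw hwu').map_collapseTo fun x hx hxu => hx (eq_of_collapseTo_eq hxu hub).1

end Shadow

section Bichromatic

variable {W : Set α} {p : α → Prop}

/-- Some simple directed cycle has an entry satisfying `p` and an entry not satisfying `p`. -/
def HasBichromaticCycle (R : α → α → Prop) (S : Set α) (p : α → Prop) : Prop :=
  ∃ a l, IsVertexCycle R a l ∧ (∃ x, p x ∧ IsEntry R S {z | z ∈ a :: l} x) ∧
    ∃ x, ¬ p x ∧ IsEntry R S {z | z ∈ a :: l} x

theorem HasBichromaticCycle.of_not (h : HasBichromaticCycle R S fun x => ¬ p x) :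
    HasBichromaticCycle R S p := by
  obtain ⟨a, l, hc, hx, y, hy, hye⟩ := h
  exact ⟨a, l, hc, ⟨y, not_not.1 hy, hye⟩, hx⟩

theorem IsVertexCycle.subset {a : α} {l : List α} (hl : IsVertexCycle R a l)
    (hmem : ∀ x y, R x y → x ∈ W ∧ y ∈ W) : {x | x ∈ a :: l} ⊆ W := by
  intro x hx
  obtain ⟨l', ⟨hc, -⟩, -⟩ := hl.exists_rotate hx
  cases l' with
  | nil => exact (hmem x x (by simpa using hc)).1
  | cons y l' => exact (hmem x y (List.isChain_cons_cons.1 hc).1).1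

/-- A bichromatic cycle of the digraph obtained by contracting the shadow of a cycle all of whose
entries have the same colour lifts to a bichromatic cycle. -/
theorem HasBichromaticCycle.of_contract_shadow (h : IsUndominated R S W) {b c : α}
    {l : List α} (hc : c ∈ W) (hcb : c ≠ b) (hl : IsVertexCycle R b l) (hbp : ¬ p b)
    (hent : ∀ x, IsEntry R S {z | z ∈ b :: l} x → ¬ p x)
    (hbi : HasBichromaticCycle (Contracted R (shadow R S W {z | z ∈ b :: l}) b)
      (collapseTo (shadow R S W {z | z ∈ b :: l}) b '' S) p) :
    HasBichromaticCycle R S p := by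
  set C : Set α := {z | z ∈ b :: l} with hCdef
  set U := shadow R S W C with hUdef
  have hCW : C ⊆ W := hl.subset h.mem
  have hbC : b ∈ C := List.mem_cons_self
  have hCU : C ⊆ U := subset_shadow hCW
  have hbU : b ∈ U := hCU hbC
  have hreach : ∀ z ∈ W, ReachIn R S Set.univ z := by
    intro z hz
    by_cases hzb : z = b
    · exact (h.reach c hc z hz (hzb ▸ hcb.symm)).mono (Set.subset_univ _)
    · exact (h.reach b (hCW hbC) z hz hzb).mono (Set.subset_univ _)
  have hS : ∀ s ∈ S, s ∈ U → IsEntry R S C s := fun s hs hsU => isEntry_of_source_mem_shadow hs hsU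
  have hin : ∀ x y, x ∉ U → y ∈ U → R x y → IsEntry R S C y :=
    fun x y hx hy hR => isEntry_of_enters_shadow h.mem hx hy hR
  have hspread : ∀ e, IsEntry R S C e → ∀ z ∈ U, ReachIn R {e} U z := fun e he z hz =>
    reachIn_shadow h.mem hCW (fun x hx y hy => hl.reachIn hx hy) he.1 (hreach z hz.1) hz
  obtain ⟨a', l', hl', ⟨x, hxp, hx⟩, y, hyp, hy⟩ := hbi
  have hrange : ∀ z ∈ a' :: l', z ≠ b → z ∉ U := by
    intro z hz hzb
    obtain ⟨w, hw⟩ := hl'.subset (W := Set.range (collapseTo U b))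
        (by rintro _ _ ⟨-, x', y', rfl, rfl, -⟩; exact ⟨⟨_, rfl⟩, ⟨_, rfl⟩⟩) hz
    exact (eq_of_collapseTo_eq hw hzb).2
  have lift_entry : ∀ (K : Set α), (∀ z ∈ K, collapseTo U b z ∈ a' :: l') →
      (∀ z ∈ a' :: l', z ≠ b → z ∈ K) → ∀ z, z ≠ b →
      IsEntry (Contracted R U b) (collapseTo U b '' S) {z | z ∈ a' :: l'} z → IsEntry R S K z := by
    intro K hK hK' z hzb hz
    have hzU : z ∉ U := hrange z hz.1 hzb
    refine ⟨hK' z hz.1 hzb,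
      (hz.2.lift hbU hS hin hspread z (collapseTo_of_notMem hzU)).mono ?_⟩
    rintro w (hw | hw)
    · exact .inl (eq_of_collapseTo_eq hw hzb).1
    · exact .inr fun hwK => hw (hK w hwK)
  have hxb : x ≠ b := fun e => hbp (e ▸ hxp)
  by_cases hb' : b ∈ a' :: l'
  swap
  · have hne : ∀ z ∈ a' :: l', z ≠ b := fun z hz e => hb' (e ▸ hz)
    have hK : ∀ z ∈ {z | z ∈ a' :: l'}, collapseTo U b z ∈ a' :: l' := fun z hz => by
      rwa [collapseTo_of_notMem (hrange z hz (hne z hz))]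
    refine ⟨a', l', ⟨?_, hl'.2⟩, ⟨x, hxp, lift_entry _ hK (fun _ h _ => h) x hxb hx⟩,
      ⟨y, hyp, lift_entry _ hK (fun _ h _ => h) y (hne y hy.1) hy⟩⟩
    refine hl'.1.imp_of_mem_imp fun z w hz hw hR => hR.of_ne (hne z ?_) (hne w ?_)
    · simpa [or_comm, or_assoc] using hz
    · simpa [or_comm, or_assoc] using hw
  obtain ⟨r, ⟨hrc, hrn⟩, hrmem⟩ := hl'.exists_rotate hb'
  obtain ⟨hbr, hrn'⟩ := List.nodup_cons.1 hrn
  have hrb : ∀ z ∈ r, z ≠ b := fun z hz e => hbr (e ▸ hz)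
  have hr_ne : r ≠ [] := by
    rintro rfl
    exact (show Contracted R U b b b by simpa using hrc).1 rfl
  have hrU : ∀ z ∈ r, z ∉ U := fun z hz =>
    hrange z ((hrmem z).1 (List.mem_cons_of_mem _ hz)) (hrb z hz)
  have hrcR : r.IsChain R :=
    (hrc.left_of_append.tail).imp_of_mem_imp fun z w hz hw hR => hR.of_ne (hrb z hz) (hrb w hw)
  -- the edges through which the lifted cycle leaves and enters `U`
  obtain ⟨f, hfU, hf⟩ : ∃ f ∈ U, ∀ z ∈ r.head?, R f z := by
    obtain ⟨z, r', rfl⟩ := List.exists_cons_of_ne_nil hr_ne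
    have hR : Contracted R U b b z := (List.isChain_cons_cons.1 hrc).1
    obtain ⟨-, f, z', hf, hz', hR⟩ := hR
    refine ⟨f, (collapseTo_eq_iff_mem hbU).1 hf, ?_⟩
    rw [(eq_of_collapseTo_eq hz' (hrb z List.mem_cons_self)).1] at hR
    simpa using hR
  obtain ⟨e, heC, he⟩ : ∃ e, IsEntry R S C e ∧ ∀ z ∈ r.getLast?, R z e := by
    have hlast := (List.isChain_append.1 hrc).2.2
    have hz := List.getLast?_eq_some_getLast hr_ne
    set z := r.getLast hr_ne
    have hzr : z ∈ r := List.getLast_mem hr_ne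
    have hR : Contracted R U b z b := hlast z (by simp [List.getLast?_cons, hz]) b (by simp)
    obtain ⟨-, z', e, hz', he, hR⟩ := hR
    rw [(eq_of_collapseTo_eq hz' (hrb z hzr)).1] at hR
    refine ⟨e, hin z e (hrU z hzr) ((collapseTo_eq_iff_mem hbU).1 he) hR, ?_⟩
    rw [hz]
    simpa using hR
  obtain ⟨m, ⟨hmc, hmn⟩, hmmem⟩ := hl.exists_rotate heC.1
  obtain ⟨m₁, m₂, t, rfl, htc, htn, htX, htl⟩ :=
    (hspread e heC f hfU).exists_path hmc.left_of_append hmn (fun z hz => hCU ((hmmem z).1 hz))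
  have hpU : ∀ z ∈ e :: m₁ ++ t, z ∈ U := by
    intro z hz
    rcases List.mem_append.1 hz with hz | hz
    · refine hCU ((hmmem z).1 ?_)
      rw [← List.cons_append]
      exact List.mem_append_left _ hz
    · exact (htX z hz).1
  have hK : ∀ z ∈ e :: (m₁ ++ t ++ r), z ∈ e :: m₁ ++ t ∨ z ∈ r := by
    intro z hz
    simpa [or_assoc] using hz
  have hKc : ∀ z ∈ {z | z ∈ e :: (m₁ ++ t ++ r)}, collapseTo U b z ∈ a' :: l' := by
    intro z hz
    rcases hK z hz with hz | hz
    · rwa [collapseTo_of_mem (hpU z hz)]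
    · rw [collapseTo_of_notMem (hrU z hz)]
      exact (hrmem z).1 (List.mem_cons_of_mem _ hz)
  have hKc' : ∀ z ∈ a' :: l', z ≠ b → z ∈ {z | z ∈ e :: (m₁ ++ t ++ r)} := by
    intro z hz hzb
    have := (List.mem_cons.1 ((hrmem z).2 hz)).resolve_left hzb
    simp [this]
  refine ⟨e, m₁ ++ t ++ r, ⟨?_, ?_⟩, ⟨x, hxp, lift_entry _ hKc hKc' x hxb hx⟩, ?_⟩
  · have h₁ : (e :: m₁ ++ t ++ (r ++ [e])).IsChain R := by
      rw [List.isChain_append]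
      refine ⟨htc, List.isChain_append.2 ⟨hrcR, by simp, fun z hz w hw => ?_⟩, ?_⟩
      · obtain rfl : e = w := by simpa using hw
        exact he z hz
      · rw [htl, List.head?_append_of_ne_nil _ hr_ne]
        intro z hz
        obtain rfl : f = z := by simpa using hz
        exact hf
    simpa using h₁
  · have h₁ : (e :: m₁ ++ t ++ r).Nodup := by
      rw [← List.cons_append, List.nodup_append] at hmn
      rw [List.nodup_append, List.nodup_append]
      refine ⟨⟨hmn.1, htn, ?_⟩, hrn', ?_⟩
      · rintro z hz _ hz' rfl
        exact (htX z hz').2 (by rw [← List.cons_append]; exact List.mem_append_left _ hz)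
      · rintro z hz _ hz' rfl
        exact hrU z hz' (hpU z hz)
    simpa using h₁
  · by_cases hyb : y = b
    swap
    · exact ⟨y, hyp, lift_entry _ hKc hKc' y hyb hy⟩
    subst hyb
    obtain ⟨g, hg, hgU, hgr⟩ := hy.2.lift_to_entrance hbU hS hin hspread (not_not.2 hy.1)
    have hsub : collapseTo U y ⁻¹' {z | z ∈ a' :: l'}ᶜ ⊆ {z | z ∈ e :: (m₁ ++ t ++ r)}ᶜ :=
      fun z hz hzK => hz (hKc z hzK)
    have hgm : g ∈ e :: m₁ ++ m₂ := by simpa using (hmmem g).2 hg.1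
    have hgK : g ∈ e :: m₁ ∨ g ∈ m₂ := List.mem_append.1 hgm
    by_cases hgm₁ : g ∈ e :: m₁
    · refine ⟨g, hent g hg, ?_, hgr.mono (Set.insert_subset_insert hsub)⟩
      rw [Set.mem_ofPred_eq, ← List.cons_append, ← List.cons_append]
      exact List.mem_append_left _ (List.mem_append_left _ hgm₁)
    · have hgm₂ := hgK.resolve_left hgm₁
      refine ⟨e, hent e heC, List.mem_cons_self, ?_⟩
      obtain ⟨q₁, q₂, rfl⟩ := List.append_of_mem hgm₂
      have hdisj : ∀ z ∈ g :: q₂, z ∉ e :: (m₁ ++ t ++ r) := by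
        intro z hz hzK
        have hzm : z ∈ q₁ ++ g :: q₂ := List.mem_append_right _ hz
        have hzm' : z ∈ e :: (m₁ ++ (q₁ ++ g :: q₂)) := by
          rw [← List.cons_append]
          exact List.mem_append_right _ hzm
        rcases hK z hzK with hzK | hzK
        · rcases List.mem_append.1 hzK with hzK | hzK
          · rw [← List.cons_append, List.nodup_append] at hmn
            exact hmn.2.2 z hzK z hzm rfl
          · exact (htX z hzK).2 hzm'
        · exact hrU z hzK (hCU ((hmmem z).1 hzm'))
      have hge : ReachIn R {g} (insert e {z | z ∈ e :: (m₁ ++ t ++ r)}ᶜ) e := by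
        have hch : (g :: (q₂ ++ [e])).IsChain R := by
          refine List.IsChain.right_of_append (l₁ := e :: (m₁ ++ q₁)) ?_
          simpa using hmc
        refine hch.reachIn (fun z hz => ?_) (by simp)
        rw [← List.cons_append] at hz
        rcases List.mem_append.1 hz with hz | hz
        · exact .inr (hdisj z hz)
        · exact .inl (by simpa using hz)
      refine (hgr.mono ?_).trans hge
      rintro z (rfl | hz)
      · exact .inr (hdisj z List.mem_cons_self)
      · exact .inr (hsub hz)

theorem IsUndominated.hasBichromaticCycle (hW : W.Finite) (h : IsUndominated R S W)
    (hp : ∃ x ∈ W, p x) (hnp : ∃ x ∈ W, ¬ p x) : HasBichromaticCycle R S p := by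
  induction hn : W.ncard using Nat.strong_induction_on generalizing R S W p with
  | _ n ih =>
  subst hn
  have aux : ∀ q : α → Prop, (∃ s ∈ S, q s) → (∃ b ∈ W, ¬ q b) → HasBichromaticCycle R S q := by
    rintro q ⟨s, hs, hqs⟩ ⟨b, hb, hqb⟩
    have hsb : s ≠ b := fun e => hqb (e ▸ hqs)
    have hsW := h.source_mem hs
    obtain ⟨l, hl, hlb⟩ := h.exists_cycle_entry hb hsW hsb
    by_cases hent : ∃ x, q x ∧ IsEntry R S {z | z ∈ b :: l} x
    · exact ⟨b, l, hl, hent, b, hqb, hlb⟩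
    have hent' : ∀ x, IsEntry R S {z | z ∈ b :: l} x → ¬ q x := fun x hx hqx => hent ⟨x, hqx, hx⟩
    have hCW := hl.subset h.mem
    have hbU : b ∈ shadow R S W {z | z ∈ b :: l} := subset_shadow hCW List.mem_cons_self
    have hsU : s ∉ shadow R S W {z | z ∈ b :: l} := fun hsU =>
      hent' s (isEntry_of_source_mem_shadow hs hsU) hqs
    have hW' : collapseTo (shadow R S W {z | z ∈ b :: l}) b '' W ⊂ W := by
      refine (Set.ssubset_iff_of_subset ?_).2 ?_
      · rintro _ ⟨x, hx, rfl⟩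
        by_cases hxU : x ∈ shadow R S W {z | z ∈ b :: l}
        · rwa [collapseTo_of_mem hxU]
        · rwa [collapseTo_of_notMem hxU]
      · cases l with
        | nil => exact absurd (by simpa using hl.1) (h.irrefl b)
        | cons d l =>
          have hd : d ∈ b :: d :: l := by simp
          refine ⟨d, hCW hd, ?_⟩
          rintro ⟨x, -, hxd⟩
          have hdb : d ≠ b := fun e => (List.nodup_cons.1 hl.2).1 (by simp [e])
          exact (eq_of_collapseTo_eq hxd hdb).2 (subset_shadow hCW hd)
    refine HasBichromaticCycle.of_contract_shadow h hsW hsb hl hqb hent' ?_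
    exact ih _ (Set.ncard_lt_ncard hW' hW) (hW.subset hW'.subset)
      (h.contract_shadow List.mem_cons_self hCW)
      ⟨s, ⟨s, hsW, collapseTo_of_notMem hsU⟩, hqs⟩ ⟨b, ⟨b, hb, collapseTo_of_mem hbU⟩, hqb⟩ rfl
  obtain ⟨x, hx, hpx⟩ := hp
  obtain ⟨y, hy, hpy⟩ := hnp
  obtain ⟨s, hs, -⟩ := (h.reach y hy x hx fun e => hpy (e ▸ hpx)).exists_source
  by_cases hps : p s
  · exact aux p ⟨s, hs, hps⟩ ⟨y, hy, hpy⟩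
  · exact (aux (fun x => ¬ p x) ⟨s, hs, hps⟩ ⟨x, hx, not_not.2 hpx⟩).of_not

end Bichromatic

end RestrictedReachability

namespace MultiDigraph

section Conversion

variable {V ε : Type*} {G : MultiDigraph V ε} {A : Finset ε}

theorem exists_isWalk_of_isChain {a y : V} {l : List V} (h : (a :: l).IsChain (G.Step A))
    (hy : (a :: l).getLast? = some y) : ∃ p, G.IsWalk A p a y ∧ p.map G.tgt = l := by
  induction l generalizing a with
  | nil => exact ⟨[], by simpa [IsWalk] using hy, rfl⟩
  | cons c l ih =>
    obtain ⟨⟨e, he, rfl, rfl⟩, hc⟩ := List.isChain_cons_cons.1 h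
    obtain ⟨p, hp, hpl⟩ := ih hc (by simpa [List.getLast?_cons_cons] using hy)
    exact ⟨e :: p, ⟨he, rfl, hp⟩, by simp [hpl]⟩

/-- The edges of `G` that do not start at the root `v`. -/
def NonrootStep (G : MultiDigraph V ε) (v x y : V) : Prop :=
  x ≠ v ∧ G.Step G.edges x y

theorem IsWalk.reachIn {v w x : V} {X : Set V} (htgt : ∀ e ∈ G.edges, G.tgt e ≠ v) {p : List ε}
    (h : G.IsWalk G.edges p x w) (hX : ∀ z ∈ p.map G.tgt, z ∈ X) (hxv : x ≠ v) (hx : x ∈ X) :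
    ReachIn (G.NonrootStep v) {x} X w := by
  induction p generalizing x with
  | nil => exact h ▸ .base rfl hx
  | cons e p ih =>
    obtain ⟨he, rfl, hp⟩ := h
    exact ReachIn.head ⟨hxv, e, he, rfl, rfl⟩ hx
      (ih hp (fun z hz => hX z (by simp_all)) (htgt e he) (hX _ (by simp)))

theorem IsWalk.reachIn_of_root {v w : V} {X : Set V} (htgt : ∀ e ∈ G.edges, G.tgt e ≠ v)
    {p : List ε} (h : G.IsWalk G.edges p v w) (hX : ∀ z ∈ p.map G.tgt, z ∈ X) (hw : w ≠ v) :
    ReachIn (G.NonrootStep v) {z | G.Step G.edges v z} X w := by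
  cases p with
  | nil => exact absurd h.symm hw
  | cons e p =>
    obtain ⟨he, hsrc, hp⟩ := h
    have heX := hX (G.tgt e) (by simp)
    have hbase : ReachIn (G.NonrootStep v) {z | G.Step G.edges v z} X (G.tgt e) :=
      .base ⟨e, he, hsrc, rfl⟩ heX
    exact hbase.trans
      (IsWalk.reachIn htgt hp (fun z hz => hX z (by simp_all)) (htgt e he) heX)

theorem exists_isPath_of_reachIn {v w : V} {X : Set V}
    (h : ReachIn (G.NonrootStep v) {z | G.Step G.edges v z} X w) :
    ∃ p, G.IsPath G.edges p v w ∧ ∀ z ∈ p.map G.tgt, z = v ∨ z ∈ X := by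
  have h' : ReachIn (G.Step G.edges) {v} (insert v X) w := by
    induction h with
    | base hs hx => exact .step (.base rfl (.inl rfl)) hs (.inr hx)
    | step _ hR hz ih => exact .step ih hR.2 (.inr hz)
  obtain ⟨t, hc, hn, htX, hl⟩ := h'.exists_simple_path
  obtain ⟨p, hp, rfl⟩ := exists_isWalk_of_isChain hc hl
  exact ⟨p, ⟨hp, hn⟩, htX⟩

theorem isUndominated_nonrootStep [DecidableEq V] (hwf : G.WellFormed) (hsimple : G.Simple) {v : V}
    (hroot : G.RootedAt v) (hsc : (G.induce (G.verts.erase v)).StronglyConnected)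
    (hdom : ∀ u ∈ G.verts, u ≠ v → ∀ w ∈ G.verts, G.Dominates v u w → w = u) :
    IsUndominated (G.NonrootStep v) {z | G.Step G.edges v z} (G.verts.erase v : Finset V) where
  irrefl := by
    rintro x ⟨-, e, he, hs, ht⟩
    exact hsimple.1 e he (hs.trans ht.symm)
  mem := by
    rintro x y ⟨hxv, e, he, rfl, rfl⟩
    simpa [hxv, hroot.2.1 e he] using hwf e he
  source_mem := by
    rintro _ ⟨e, he, -, rfl⟩
    simpa [hroot.2.1 e he] using (hwf e he).2
  strong := by
    intro x hx y hy
    have h := hsc x hx y hy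
    induction h with
    | refl => exact .base rfl trivial
    | tail _ hstep ih =>
      obtain ⟨e, he, rfl, rfl⟩ := hstep
      obtain ⟨he, hs, ht⟩ := Finset.mem_filter.1 he
      exact .step (ih hs) ⟨(Finset.mem_erase.1 hs).1, e, he, rfl, rfl⟩ trivial
  reach := by
    intro u hu w hw hwu
    obtain ⟨huv, hu⟩ := Finset.mem_erase.1 hu
    obtain ⟨hwv, hw⟩ := Finset.mem_erase.1 hw
    have hnd : ¬ G.Dominates v u w := fun h => hwu (hdom u hu huv w hw h)
    simp only [Dominates, not_forall] at hnd
    obtain ⟨p, hp, hup⟩ := hnd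
    exact IsWalk.reachIn_of_root hroot.2.1 hp.1
      (fun z hz hzu => hup (List.mem_cons_of_mem _ (hzu ▸ hz))) hwv

theorem exists_isCycle_of_isVertexCycle {v a : V} {l : List V}
    (h : IsVertexCycle (G.NonrootStep v) a l) :
    ∃ C, G.IsCycle G.edges C a ∧ ∀ z, z ∈ C.map G.tgt ↔ z ∈ a :: l := by
  obtain ⟨hc, hn⟩ := h
  have hc' : (a :: (l ++ [a])).IsChain (G.Step G.edges) := hc.imp fun _ _ h => h.2
  obtain ⟨C, hC, hCl⟩ := exists_isWalk_of_isChain (y := a) hc'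
    (by rw [← List.cons_append, List.getLast?_concat])
  refine ⟨C, ⟨?_, hC, ?_⟩, ?_⟩
  · rintro rfl
    simp at hCl
  · rw [hCl]
    exact (List.perm_append_comm (l₁ := l) (l₂ := [a])).nodup_iff.2 hn
  · intro z
    simp [hCl, or_comm]

theorem isIndependentVertex_of_isEntry {v x : V} {C : List ε} {K : Set V}
    (hK : ∀ z, z ∈ C.map G.tgt ↔ z ∈ K) (hv : v ∉ K)
    (h : IsEntry (G.NonrootStep v) {z | G.Step G.edges v z} K x) :
    G.IsIndependentVertex v C x := by
  obtain ⟨p, hp, hpX⟩ := exists_isPath_of_reachIn h.2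
  refine ⟨(hK x).2 h.1, p, hp, fun z hz hzC => ?_⟩
  have hzK := (hK z).1 hzC
  have hzv : z ≠ v := fun e => hv (e ▸ hzK)
  have hzp := (List.mem_cons.1 hz).resolve_left hzv
  exact ((hpX z hzp).resolve_left hzv).resolve_right fun h' => h' hzK

end Conversion

end MultiDigraph

open MvPolynomial

variable {V : Type*} {ε : Type*} [DecidableEq V] [DecidableEq ε]

/-- Let `G` be rooted at `v` with `G[V∖{v}]` strongly connected and no
non-trivial dominators, and let `V₁, V₂` be a partition of `V∖{v}` into two nonempty
sets.  Then some simple directed cycle has an independent vertex in `V₁` and an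
independent vertex in `V₂`. -/
theorem statement_6 (G : MultiDigraph V ε) (hwf : G.WellFormed) (hsimple : G.Simple)
    (v : V) (hroot : G.RootedAt v)
    (hsc : (G.induce (G.verts.erase v)).StronglyConnected)
    (hdom : ∀ u ∈ G.verts, u ≠ v → ∀ w ∈ G.verts, G.Dominates v u w → w = u)
    (V₁ V₂ : Finset V) (hdis : Disjoint V₁ V₂) (hunion : V₁ ∪ V₂ = G.verts.erase v)
    (h1 : V₁.Nonempty) (h2 : V₂.Nonempty) :
    ∃ (C : List ε) (x : V), G.IsCycle G.edges C x ∧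
      (∃ a ∈ V₁, G.IsIndependentVertex v C a) ∧
      (∃ b ∈ V₂, G.IsIndependentVertex v C b) := by
  have hnet := MultiDigraph.isUndominated_nonrootStep hwf hsimple hroot hsc hdom
  obtain ⟨x, hx⟩ := h1
  obtain ⟨y, hy⟩ := h2
  have hmem : ∀ z, z ∈ G.verts.erase v ↔ z ∈ V₁ ∨ z ∈ V₂ := fun z => by
    rw [← hunion, Finset.mem_union]
  obtain ⟨a, l, hl, ⟨s, hs, hse⟩, t, ht, hte⟩ :=
    hnet.hasBichromaticCycle (p := fun z => z ∈ V₁) (Finset.finite_toSet _)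
      ⟨x, (hmem x).2 (.inl hx), hx⟩
      ⟨y, (hmem y).2 (.inr hy), Finset.disjoint_right.1 hdis hy⟩
  have hsub := hl.subset hnet.mem
  have hv : v ∉ {z | z ∈ a :: l} := fun h => (Finset.mem_erase.1 (hsub h)).1 rfl
  obtain ⟨C, hC, hCl⟩ := MultiDigraph.exists_isCycle_of_isVertexCycle hl
  exact ⟨C, a, hC, ⟨s, hs, MultiDigraph.isIndependentVertex_of_isEntry hCl hv hse⟩,
    t, ((hmem t).1 (hsub hte.1)).resolve_left ht,
    MultiDigraph.isIndependentVertex_of_isEntry hCl hv hte⟩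
end
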